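/- Max-Cut of sparse Erdős–Rényi graphs: for every ε > 0 there exists γ₀ < ∞ such that for every γ ≥ γ₀, if G ~ G(n, ⌊γn⌋) is a uniformly random simple graph on n vertices with ⌊γn⌋ edges, then P( |MaxCut(G)/n − (γ/2 + P_*·√(γ/2))| ≤ ε·√γ ) → 1 as n → ∞. (That is, w.h.p. MaxCut(G)/n = γ/2 + P_*√(γ/2) + o_γ(√γ).) -/

import Mathlib

open MeasureTheory Filter Finset

/-- The real value (±1) of a Boolean spin. -/
noncomputable def spin (b : Bool) : ℝ := if b then 1 else -1

/-- The Sherrington–Kirkpatrick Hamiltonian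
`H^SK_n(σ) = -(2n)^{-1/2} Σ_{i,j} J_{ij} σ_i σ_j`. -/
noncomputable def HSK (n : ℕ) (J : Fin n × Fin n → ℝ) (σ : Fin n → Bool) : ℝ :=
  -(Real.sqrt (2 * n))⁻¹ * ∑ p : Fin n × Fin n, J p * spin (σ p.1) * spin (σ p.2)

/-- The law of the i.i.d. standard Gaussian couplings `(J_{ij})`. -/
noncomputable def skMeasure (n : ℕ) : Measure ((Fin n × Fin n) → ℝ) :=
  Measure.pi fun _ => ProbabilityTheory.gaussianReal 0 1

open Classical in
/-- The cut size of the partition `(S, Sᶜ)` in the graph `G`. -/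
noncomputable def cutSize {n : ℕ} (G : SimpleGraph (Fin n)) (S : Finset (Fin n)) : ℕ :=
  ∑ i ∈ S, ∑ j ∈ Sᶜ, if G.Adj i j then 1 else 0

/-- `S` induces a bisection: the sizes of the two parts differ by at most one. -/
def IsBisection {n : ℕ} (S : Finset (Fin n)) : Prop :=
  (n : ℤ) - 1 ≤ 2 * S.card ∧ (2 * S.card : ℤ) ≤ n + 1

/-- Max-Cut: the maximum cut size over all (unconstrained) two-part
partitions of the vertex set. -/
noncomputable def MaxCut {n : ℕ} (G : SimpleGraph (Fin n)) : ℕ :=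
  sSup {k : ℕ | ∃ S : Finset (Fin n), cutSize G S = k}

/-- Probability that a uniformly random element of the (finite) set `A`
lies in the set `B`. -/
noncomputable def probUniform {α : Type*} (A B : Set α) : ℝ :=
  ((A ∩ B).ncard : ℝ) / (A.ncard : ℝ)

/-- Bernoulli(p) expectation over subsets of `S`. -/
noncomputable def bE {ι : Type*} (p : ℝ) (S : Finset ι) (f : Finset ι → ℝ) : ℝ :=
  ∑ T ∈ S.powerset, p ^ T.card * (1 - p) ^ (S.card - T.card) * f T

lemma bE_empty {ι : Type*} (p : ℝ) (f : Finset ι → ℝ) : bE p ∅ f = f ∅ := by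
  simp [bE]

lemma bE_insert {ι : Type*} [DecidableEq ι] (p : ℝ) (S : Finset ι) (e : ι) (he : e ∉ S)
    (f : Finset ι → ℝ) :
    bE p (insert e S) f = (1 - p) * bE p S f + p * bE p S (fun T => f (insert e T)) := by
  unfold bE
  rw [Finset.sum_powerset_insert he, Finset.mul_sum, Finset.mul_sum]
  congr 1
  · refine Finset.sum_congr rfl fun T hT => ?_
    have h1 := Finset.card_le_card (Finset.mem_powerset.1 hT)
    rw [Finset.card_insert_of_notMem he, Nat.succ_sub h1, pow_succ]
    ring
  · refine Finset.sum_congr rfl fun T hT => ?_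
    have h2 : e ∉ T := fun h => he (Finset.mem_powerset.1 hT h)
    rw [Finset.card_insert_of_notMem he, Finset.card_insert_of_notMem h2, Nat.add_sub_add_right,
      pow_succ]
    ring

lemma bE_mono {ι : Type*} {p : ℝ} (h0 : 0 ≤ p) (h1 : p ≤ 1) (S : Finset ι)
    {f g : Finset ι → ℝ} (h : ∀ T ⊆ S, f T ≤ g T) : bE p S f ≤ bE p S g := by
  unfold bE
  refine Finset.sum_le_sum fun T hT => ?_
  have := h T (Finset.mem_powerset.1 hT)
  have h1' : 0 ≤ 1 - p := by linarith
  gcongr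

lemma bE_congr {ι : Type*} {p : ℝ} (S : Finset ι)
    {f g : Finset ι → ℝ} (h : ∀ T ⊆ S, f T = g T) : bE p S f = bE p S g := by
  unfold bE
  refine Finset.sum_congr rfl fun T hT => ?_
  rw [h T (Finset.mem_powerset.1 hT)]

lemma bE_add {ι : Type*} (p : ℝ) (S : Finset ι) (f g : Finset ι → ℝ) :
    bE p S (fun T => f T + g T) = bE p S f + bE p S g := by
  unfold bE
  rw [← Finset.sum_add_distrib]
  exact Finset.sum_congr rfl fun T _ => by ring

lemma bE_smul {ι : Type*} (p c : ℝ) (S : Finset ι) (f : Finset ι → ℝ) :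
    bE p S (fun T => c * f T) = c * bE p S f := by
  unfold bE
  rw [Finset.mul_sum]
  exact Finset.sum_congr rfl fun T _ => by ring

lemma bE_const {ι : Type*} (p c : ℝ) (S : Finset ι) : bE p S (fun _ => c) = c := by
  classical
  induction S using Finset.induction_on with
  | empty => simp [bE_empty]
  | insert e S he ih => rw [bE_insert p S e he, ih]; ring

lemma bE_card {ι : Type*} (p : ℝ) (S : Finset ι) :
    bE p S (fun T => (T.card : ℝ)) = S.card * p := by
  classical
  induction S using Finset.induction_on with
  | empty => simp [bE_empty]
  | insert e S he ih =>
    rw [bE_insert p S e he, ih]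
    have : bE p S (fun T => ((insert e T).card : ℝ)) = bE p S (fun T => (T.card : ℝ) + 1) := by
      refine bE_congr S fun T hT => ?_
      rw [Finset.card_insert_of_notMem fun h => he (hT h)]; push_cast; ring
    rw [this, bE_add, bE_const, ih, Finset.card_insert_of_notMem he]
    push_cast; ring

lemma bE_var {ι : Type*} [DecidableEq ι] {p : ℝ} (h0 : 0 ≤ p) (h1 : p ≤ 1) (S : Finset ι) :
    ∀ (f : Finset ι → ℝ), (∀ T ⊆ S, ∀ e ∈ S, |f (insert e T) - f T| ≤ 1) →
    bE p S (fun T => f T ^ 2) ≤ (bE p S f) ^ 2 + S.card * (p * (1 - p)) := by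
  induction S using Finset.induction_on with
  | empty => intro f _; simp [bE_empty]
  | insert e S he ih =>
    intro f hf
    have i0 := ih f (fun T hT e' he' => hf T (hT.trans (Finset.subset_insert _ _)) e'
      (Finset.mem_insert_of_mem he'))
    have i1 := ih (fun T => f (insert e T)) (fun T hT e' he' => by
      have := hf (insert e T) (Finset.insert_subset_insert _ hT) e' (Finset.mem_insert_of_mem he')
      rwa [Finset.insert_comm] at this)
    rw [bE_insert p S e he, bE_insert p S e he, Finset.card_insert_of_notMem he]
    set a := bE p S f
    set b := bE p S (fun T => f (insert e T))
    have hd : ∀ T ⊆ S, |f (insert e T) - f T| ≤ 1 := fun T hT =>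
      hf T (hT.trans (Finset.subset_insert _ _)) e (Finset.mem_insert_self _ _)
    have u1 : b ≤ a + 1 := by
      have := bE_mono h0 h1 S (f := fun T => f (insert e T)) (g := fun T => f T + 1)
        (fun T hT => by have := abs_le.1 (hd T hT); linarith)
      rwa [bE_add, bE_const] at this
    have u2 : a ≤ b + 1 := by
      have := bE_mono h0 h1 S (f := f) (g := fun T => f (insert e T) + 1)
        (fun T hT => by have := abs_le.1 (hd T hT); linarith)
      rwa [bE_add, bE_const] at this
    have h1' : 0 ≤ 1 - p := by linarith
    have u3 : (b - a) ^ 2 ≤ 1 := by nlinarith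
    have u4 : p * (1 - p) * (b - a) ^ 2 ≤ p * (1 - p) * 1 :=
      mul_le_mul_of_nonneg_left u3 (mul_nonneg h0 h1')
    push_cast
    have v0 := mul_le_mul_of_nonneg_left i0 h1'
    have v1 := mul_le_mul_of_nonneg_left i1 h0
    nlinarith

lemma bE_abs_le {ι : Type*} {p : ℝ} (h0 : 0 ≤ p) (h1 : p ≤ 1) (S : Finset ι)
    (f : Finset ι → ℝ) : bE p S (fun T => |f T|) ≤ Real.sqrt (bE p S (fun T => f T ^ 2)) := by
  apply Real.le_sqrt_of_sq_le
  set a := bE p S (fun T => |f T|)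
  have : bE p S (fun T => 2 * a * |f T| + (- a ^ 2)) ≤ bE p S (fun T => f T ^ 2) := by
    refine bE_mono h0 h1 S fun T _ => ?_
    nlinarith [sq_nonneg (|f T| - a), sq_abs (f T)]
  rw [bE_add, bE_smul, bE_const] at this
  nlinarith

lemma bE_dev {ι : Type*} [DecidableEq ι] {p : ℝ} (h0 : 0 ≤ p) (h1 : p ≤ 1) (S : Finset ι)
    (f : Finset ι → ℝ) (hf : ∀ T ⊆ S, ∀ e ∈ S, |f (insert e T) - f T| ≤ 1) :
    bE p S (fun T => |f T - bE p S f|) ≤ Real.sqrt (S.card * p) := by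
  refine (bE_abs_le h0 h1 S _).trans (Real.sqrt_le_sqrt ?_)
  have := bE_var h0 h1 S f hf
  set a := bE p S f with ha
  have h2 : bE p S (fun T => (f T - a) ^ 2)
      = bE p S (fun T => f T ^ 2 + ((-2 * a) * f T + a ^ 2)) :=
    bE_congr S fun T _ => by ring
  rw [h2, bE_add, bE_add, bE_smul, bE_const, ← ha]
  have h3 : (S.card : ℝ) * (p * (1 - p)) ≤ S.card * p := by
    gcongr; nlinarith
  linarith

/-- uniform average over `k`-subsets -/
noncomputable def uE {ι : Type*} (k : ℕ) (S : Finset ι) (f : Finset ι → ℝ) : ℝ :=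
  (∑ T ∈ S.powersetCard k, f T) / (S.card.choose k)

lemma sum_powersetCard_succ {ι : Type*} [DecidableEq ι] (k : ℕ) (S : Finset ι)
    (f : Finset ι → ℝ) :
    ∑ T ∈ S.powersetCard (k + 1), ∑ e ∈ T, f (T.erase e)
      = ((S.card - k : ℕ) : ℝ) * ∑ T ∈ S.powersetCard k, f T := by
  have : ∀ T ∈ S.powersetCard k, ((S.card - k : ℕ) : ℝ) * f T = ∑ e ∈ S \ T, f T := by
    intro T hT
    rw [Finset.mem_powersetCard] at hT
    rw [Finset.sum_const, Finset.card_sdiff_of_subset hT.1, hT.2, nsmul_eq_mul]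
  rw [Finset.mul_sum, Finset.sum_congr rfl this, Finset.sum_sigma', Finset.sum_sigma']
  refine Finset.sum_bij' (fun x _ => ⟨x.1.erase x.2, x.2⟩) (fun x _ => ⟨insert x.2 x.1, x.2⟩)
    ?_ ?_ ?_ ?_ ?_
  · rintro ⟨T, e⟩ h
    simp only [Finset.mem_sigma, Finset.mem_powersetCard, Finset.mem_sdiff] at h ⊢
    obtain ⟨⟨h1, h2⟩, h3⟩ := h
    refine ⟨⟨(Finset.erase_subset _ _).trans h1, ?_⟩, h1 h3, Finset.notMem_erase _ _⟩
    rw [Finset.card_erase_of_mem h3, h2]; rfl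
  · rintro ⟨T, e⟩ h
    simp only [Finset.mem_sigma, Finset.mem_powersetCard, Finset.mem_sdiff] at h ⊢
    obtain ⟨⟨h1, h2⟩, h3, h4⟩ := h
    refine ⟨⟨Finset.insert_subset h3 h1, ?_⟩, Finset.mem_insert_self _ _⟩
    rw [Finset.card_insert_of_notMem h4, h2]
  · rintro ⟨T, e⟩ h
    simp only [Finset.mem_sigma] at h
    simp [Finset.insert_erase h.2]
  · rintro ⟨T, e⟩ h
    simp only [Finset.mem_sigma, Finset.mem_sdiff] at h
    simp [Finset.erase_insert h.2.2]
  · rintro ⟨T, e⟩ h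
    rfl

lemma uE_step {ι : Type*} [DecidableEq ι] (k : ℕ) (S : Finset ι) (hk : k + 1 ≤ S.card)
    (f : Finset ι → ℝ) (hf : ∀ T ⊆ S, ∀ e ∈ S, |f (insert e T) - f T| ≤ 1) :
    |uE (k + 1) S f - uE k S f| ≤ 1 := by
  have key := sum_powersetCard_succ k S f
  have c1 : 0 < (S.card.choose (k + 1) : ℝ) := by exact_mod_cast Nat.choose_pos hk
  have c0 : 0 < (S.card.choose k : ℝ) := by exact_mod_cast Nat.choose_pos (by omega)
  have cc : (S.card.choose (k + 1) : ℝ) * (k + 1) = S.card.choose k * ((S.card - k : ℕ) : ℝ) := by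
    exact_mod_cast Nat.choose_succ_right_eq S.card k
  have h2 : |∑ T ∈ S.powersetCard (k + 1), ((k + 1 : ℝ) * f T - ∑ e ∈ T, f (T.erase e))|
      ≤ ∑ T ∈ S.powersetCard (k + 1), (k + 1 : ℝ) := by
    refine (Finset.abs_sum_le_sum_abs _ _).trans (Finset.sum_le_sum fun T hT => ?_)
    rw [Finset.mem_powersetCard] at hT
    have h3 : (k + 1 : ℝ) * f T = ∑ e ∈ T, f T := by
      rw [Finset.sum_const, hT.2, nsmul_eq_mul]; push_cast; ring
    rw [h3, ← Finset.sum_sub_distrib]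
    refine (Finset.abs_sum_le_sum_abs _ _).trans ?_
    have : (k + 1 : ℝ) = ∑ e ∈ T, (1 : ℝ) := by simp [hT.2]
    rw [this]
    refine Finset.sum_le_sum fun e he => ?_
    have := hf (T.erase e) ((Finset.erase_subset _ _).trans hT.1) e (hT.1 he)
    rwa [Finset.insert_erase he] at this
  rw [Finset.sum_sub_distrib, key, ← Finset.mul_sum, Finset.sum_const, Finset.card_powersetCard,
    nsmul_eq_mul] at h2
  unfold uE
  have e1 : (∑ T ∈ S.powersetCard k, f T) / (S.card.choose k : ℝ)
     = (((S.card - k : ℕ) : ℝ) * ∑ T ∈ S.powersetCard k, f T)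
        / ((S.card.choose (k + 1) : ℝ) * (k + 1)) := by
    have : ((S.card - k : ℕ) : ℝ) ≠ 0 := by
      have : 0 < S.card - k := by omega
      positivity
    rw [cc]; field_simp
  have e2 : (∑ T ∈ S.powersetCard (k + 1), f T) / (S.card.choose (k + 1) : ℝ)
     = ((k + 1 : ℝ) * ∑ T ∈ S.powersetCard (k + 1), f T)
        / ((S.card.choose (k + 1) : ℝ) * (k + 1)) := by
    field_simp
  rw [e1, e2, ← sub_div, abs_div, abs_of_pos (a := (S.card.choose (k + 1) : ℝ) * (k + 1))
    (by positivity), div_le_one (by positivity)]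
  exact h2

lemma uE_lip {ι : Type*} [DecidableEq ι] (S : Finset ι)
    (f : Finset ι → ℝ) (hf : ∀ T ⊆ S, ∀ e ∈ S, |f (insert e T) - f T| ≤ 1) (k d : ℕ)
    (hk : k + d ≤ S.card) : |uE (k + d) S f - uE k S f| ≤ d := by
  induction d with
  | zero => simp
  | succ d ih =>
    have h1 := ih (by omega)
    have h2 := uE_step (k + d) S (by omega) f hf
    rw [← add_assoc]
    push_cast
    have := abs_add_le (uE (k + d + 1) S f - uE (k + d) S f) (uE (k + d) S f - uE k S f)
    rw [sub_add_sub_cancel] at this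
    linarith

lemma uE_lip' {ι : Type*} [DecidableEq ι] (S : Finset ι)
    (f : Finset ι → ℝ) (hf : ∀ T ⊆ S, ∀ e ∈ S, |f (insert e T) - f T| ≤ 1) (k m : ℕ)
    (hk : k ≤ S.card) (hm : m ≤ S.card) : uE m S f ≤ uE k S f + |(k : ℝ) - m| := by
  rcases le_total k m with h | h
  · obtain ⟨d, rfl⟩ := Nat.exists_eq_add_of_le h
    have := abs_le.1 (uE_lip S f hf k d hm)
    have h3 : |(k : ℝ) - (k + d : ℕ)| = d := by
      push_cast; rw [sub_add_cancel_left, abs_neg, Nat.abs_cast]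
    rw [h3]; linarith
  · obtain ⟨d, rfl⟩ := Nat.exists_eq_add_of_le h
    have := abs_le.1 (uE_lip S f hf m d hk)
    have h3 : |((m + d : ℕ) : ℝ) - m| = d := by
      push_cast; rw [add_sub_cancel_left, Nat.abs_cast]
    rw [h3]; linarith

lemma bE_uE {ι : Type*} (p : ℝ) (S : Finset ι) (f : Finset ι → ℝ) :
    bE p S (fun T => uE T.card S f) = bE p S f := by
  unfold bE
  rw [Finset.sum_powerset, Finset.sum_powerset]
  refine Finset.sum_congr rfl fun k hk => ?_
  have hk' : k ≤ S.card := by simpa [Nat.lt_succ_iff] using hk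
  have e1 : ∀ g : Finset ι → ℝ,
      ∑ T ∈ S.powersetCard k, p ^ T.card * (1 - p) ^ (S.card - T.card) * g T
      = p ^ k * (1 - p) ^ (S.card - k) * ∑ T ∈ S.powersetCard k, g T := by
    intro g
    rw [Finset.mul_sum]
    refine Finset.sum_congr rfl fun T hT => ?_
    rw [(Finset.mem_powersetCard.1 hT).2]
  rw [e1, e1]
  congr 1
  have : ∀ T ∈ S.powersetCard k, uE T.card S f = uE k S f := fun T hT => by
    rw [(Finset.mem_powersetCard.1 hT).2]
  rw [Finset.sum_congr rfl this, Finset.sum_const, Finset.card_powersetCard, nsmul_eq_mul, uE]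
  have c0 : 0 < (S.card.choose k : ℝ) := by exact_mod_cast Nat.choose_pos hk'
  field_simp

/-- concentration in the fixed-size model, centred at the Bernoulli mean -/
lemma uE_dev {ι : Type*} [DecidableEq ι] {p : ℝ} (h0 : 0 ≤ p) (h1 : p ≤ 1) (S : Finset ι)
    (f : Finset ι → ℝ) (hf : ∀ T ⊆ S, ∀ e ∈ S, |f (insert e T) - f T| ≤ 1) (m : ℕ)
    (hm : m ≤ S.card) :
    uE m S (fun T => |f T - bE p S f|)
      ≤ 2 * Real.sqrt (S.card * p) + |(S.card : ℝ) * p - m| := by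
  set c := bE p S f with hc
  set g : Finset ι → ℝ := fun T => |f T - c| with hg
  have hgl : ∀ T ⊆ S, ∀ e ∈ S, |g (insert e T) - g T| ≤ 1 := by
    intro T hT e he
    refine (abs_abs_sub_abs_le_abs_sub _ _).trans ?_
    rw [sub_sub_sub_cancel_right]; exact hf T hT e he
  have s1 : uE m S g ≤ bE p S (fun T => uE T.card S g + (|(T.card : ℝ) - S.card * p|
      + |(S.card : ℝ) * p - m|)) := by
    rw [← bE_const p (uE m S g) S]
    refine bE_mono h0 h1 S fun T hT => ?_
    have := uE_lip' S g hgl T.card m (Finset.card_le_card hT) hm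
    have h2 := abs_sub_le (T.card : ℝ) (S.card * p) m
    linarith
  rw [bE_add, bE_add, bE_const, bE_uE] at s1
  have s2 : bE p S g ≤ _ := bE_dev h0 h1 S f hf
  have s3 := bE_dev h0 h1 S (fun T => (T.card : ℝ)) (fun T hT e he => by
    by_cases h : e ∈ T
    · simp [Finset.insert_eq_of_mem h]
    · simp [Finset.card_insert_of_notMem h])
  rw [bE_card] at s3
  linarith

/-- Second-order Taylor expansion of `t ↦ log (P e^t + Q e^{-t})`. -/
lemma log_taylor (P Q : ℝ) (hP : 0 ≤ P) (hQ : 0 ≤ Q) (h : 0 < P + Q) :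
    ∃ c1 c2 : ℝ, |c1| ≤ 1 ∧ |c2| ≤ 1 ∧ ∀ t : ℝ,
      |Real.log (P * Real.exp t + Q * Real.exp (-t)) - Real.log (P + Q) - c1 * t - c2 * t ^ 2|
        ≤ 2 * |t| ^ 3 := by
  set D : ℝ → ℝ := fun t => P * Real.exp t + Q * Real.exp (-t) with hD
  set U : ℝ → ℝ := fun t => P * Real.exp t - Q * Real.exp (-t) with hU
  have Dpos : ∀ t, 0 < D t := by
    intro t
    have e1 := Real.exp_pos t
    have e2 := Real.exp_pos (-t)
    rcases hP.lt_or_eq with h1 | h1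
    · have : 0 < P * Real.exp t := by positivity
      have : 0 ≤ Q * Real.exp (-t) := by positivity
      simp only [hD]; linarith
    · have hQ' : 0 < Q := by linarith
      have : 0 < Q * Real.exp (-t) := by positivity
      have : 0 ≤ P * Real.exp t := by positivity
      simp only [hD]; linarith
  have dD : ∀ t, HasDerivAt D (U t) t := by
    intro t
    have h1 := (Real.hasDerivAt_exp t).const_mul P
    have h2 := ((Real.hasDerivAt_exp (-t)).comp t (hasDerivAt_neg t)).const_mul Q
    have := h1.add h2
    refine this.congr_deriv ?_
    simp only [hU]; ring
  have dU : ∀ t, HasDerivAt U (D t) t := by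
    intro t
    have h1 := (Real.hasDerivAt_exp t).const_mul P
    have h2 := ((Real.hasDerivAt_exp (-t)).comp t (hasDerivAt_neg t)).const_mul Q
    have := h1.sub h2
    refine this.congr_deriv ?_
    simp only [hD]; ring
  set r : ℝ → ℝ := fun t => U t / D t with hr
  have dr : ∀ t, HasDerivAt r (1 - r t ^ 2) t := by
    intro t
    refine ((dU t).div (dD t) (Dpos t).ne').congr_deriv ?_
    have := (Dpos t).ne'
    simp only [hr]; field_simp
  have rabs : ∀ t, |r t| ≤ 1 := by
    intro t
    simp only [hr]
    rw [abs_div, abs_of_pos (Dpos t), div_le_one (Dpos t)]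
    have : 0 ≤ P * Real.exp t := by positivity
    have : 0 ≤ Q * Real.exp (-t) := by positivity
    simp only [hU, hD]
    rw [abs_le]; constructor <;> linarith
  have rsq : ∀ t, r t ^ 2 ≤ 1 := fun t => by
    rw [← sq_abs]; exact pow_le_one₀ (abs_nonneg _) (rabs t)
  have rlip : ∀ s, |r s - r 0| ≤ |s| := by
    intro s
    have := Convex.norm_image_sub_le_of_norm_hasDerivWithin_le (f := r) (s := Set.univ) (C := 1)
      (x := 0) (y := s) (fun x _ => (dr x).hasDerivWithinAt) (fun x _ => by
        rw [Real.norm_eq_abs, abs_le]; constructor <;> nlinarith [rsq x, sq_nonneg (r x)])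
      convex_univ trivial trivial
    simpa using this
  refine ⟨r 0, (1 - r 0 ^ 2) / 2, rabs 0, ?_, ?_⟩
  · rw [abs_le]; constructor <;> nlinarith [rsq 0, sq_nonneg (r 0)]
  intro t
  set K : Set ℝ := Set.Icc (-|t|) |t| with hK
  have K0 : (0 : ℝ) ∈ K := ⟨by simp, by simp⟩
  have Kt : t ∈ K := ⟨neg_abs_le t, le_abs_self t⟩
  -- derivative bound
  have b1 : ∀ s ∈ K, |r s - r 0 - (1 - r 0 ^ 2) * s| ≤ 2 * |t| * |t| := by
    intro s hs
    have hs' : |s| ≤ |t| := abs_le.2 hs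
    have := Convex.norm_image_sub_le_of_norm_hasDerivWithin_le
      (f := fun s => r s - (1 - r 0 ^ 2) * s) (f' := fun s => (1 - r s ^ 2) - (1 - r 0 ^ 2) * 1)
      (s := K) (C := 2 * |t|)
      (x := 0) (y := s) (fun x _ => ((dr x).sub ((hasDerivAt_id x).const_mul _)).hasDerivWithinAt)
      (fun x hx => by
        have hx' : |x| ≤ |t| := abs_le.2 hx
        have e : (1 - r x ^ 2) - (1 - r 0 ^ 2) * 1 = (r x - r 0) * (-(r x + r 0)) := by ring
        rw [Real.norm_eq_abs, e, abs_mul, abs_neg]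
        have h1 := (rlip x).trans hx'
        have h2 : |r x + r 0| ≤ 2 := (abs_add_le _ _).trans (by linarith [rabs x, rabs 0])
        have := mul_le_mul h1 h2 (abs_nonneg _) (abs_nonneg _)
        linarith)
      (convex_Icc _ _) K0 hs
    simp only [Real.norm_eq_abs, mul_zero, sub_zero] at this
    have e : r s - r 0 - (1 - r 0 ^ 2) * s = r s - (1 - r 0 ^ 2) * s - r 0 := by ring
    rw [e]
    refine this.trans ?_
    gcongr
  have := Convex.norm_image_sub_le_of_norm_hasDerivWithin_le
      (f := fun s => Real.log (D s) - r 0 * s - (1 - r 0 ^ 2) / 2 * s ^ 2)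
      (f' := fun s => U s / D s - r 0 * 1 - (1 - r 0 ^ 2) / 2 * (2 * s))
      (s := K) (C := 2 * |t| * |t|)
      (x := 0) (y := t) (fun x _ => by
        have h1 := ((dD x).log (Dpos x).ne').sub ((hasDerivAt_id x).const_mul (r 0))
        have h2 := h1.sub ((hasDerivAt_pow 2 x).const_mul ((1 - r 0 ^ 2) / 2))
        refine HasDerivAt.hasDerivWithinAt ?_
        refine h2.congr_deriv ?_
        norm_num)
      (fun x hx => by
        have h3 := b1 x hx
        have e : U x / D x - r 0 * 1 - (1 - r 0 ^ 2) / 2 * (2 * x)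
          = r x - r 0 - (1 - r 0 ^ 2) * x := by simp only [hr]; ring
        rw [Real.norm_eq_abs, e]; exact h3)
      (convex_Icc _ _) K0 Kt
  have D0 : D 0 = P + Q := by simp [hD]
  simp only [Real.norm_eq_abs, D0] at this
  have e : Real.log (D t) - Real.log (P + Q) - r 0 * t - (1 - r 0 ^ 2) / 2 * t ^ 2
     = Real.log (D t) - r 0 * t - (1 - r 0 ^ 2) / 2 * t ^ 2
       - (Real.log (P + Q) - r 0 * 0 - (1 - r 0 ^ 2) / 2 * 0 ^ 2) := by ring
  rw [e]
  refine this.trans (le_of_eq ?_)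
  rw [sub_zero]; ring

/-- log-sum-exp -/
noncomputable def lse {Λ : Type*} [Fintype Λ] (u : Λ → ℝ) : ℝ := Real.log (∑ σ, Real.exp (u σ))

lemma lse_taylor {Λ : Type*} [Fintype Λ] [Nonempty Λ] (u s : Λ → ℝ)
    (hs : ∀ σ, s σ = 1 ∨ s σ = -1) :
    ∃ c0 c1 c2 : ℝ, ∀ t : ℝ,
      |lse (fun σ => u σ + t * s σ) - (c0 + c1 * t + c2 * t ^ 2)| ≤ 2 * |t| ^ 3 := by
  classical
  set P := ∑ σ, if s σ = 1 then Real.exp (u σ) else 0 with hP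
  set Q := ∑ σ, if s σ = 1 then 0 else Real.exp (u σ) with hQ
  have hPQ : P + Q = ∑ σ, Real.exp (u σ) := by
    rw [hP, hQ, ← Finset.sum_add_distrib]
    exact Finset.sum_congr rfl fun σ _ => by split_ifs <;> simp
  have hpos : 0 < P + Q := by
    rw [hPQ]; exact Finset.sum_pos (fun _ _ => Real.exp_pos _) Finset.univ_nonempty
  obtain ⟨c1, c2, -, -, hc⟩ := log_taylor P Q
    (Finset.sum_nonneg fun σ _ => by split_ifs <;> positivity)
    (Finset.sum_nonneg fun σ _ => by split_ifs <;> positivity) hpos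
  refine ⟨Real.log (P + Q), c1, c2, fun t => ?_⟩
  have e : lse (fun σ => u σ + t * s σ) = Real.log (P * Real.exp t + Q * Real.exp (-t)) := by
    unfold lse
    congr 1
    rw [hP, hQ, Finset.sum_mul, Finset.sum_mul, ← Finset.sum_add_distrib]
    refine Finset.sum_congr rfl fun σ _ => ?_
    rw [Real.exp_add]
    rcases hs σ with h | h
    · simp [h]
    · have : ¬ ((-1 : ℝ) = 1) := by norm_num
      simp [h, this]
  rw [e]
  have := hc t
  convert this using 2
  ring

lemma lse_continuous {Λ : Type*} [Fintype Λ] [Nonempty Λ] :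
    Continuous (lse : (Λ → ℝ) → ℝ) := by
  unfold lse
  refine Continuous.log (by fun_prop) fun u => ?_
  exact (Finset.sum_pos (fun _ _ => Real.exp_pos _) Finset.univ_nonempty).ne'

lemma lse_le_add {Λ : Type*} [Fintype Λ] [Nonempty Λ] (u v : Λ → ℝ) (C : ℝ)
    (h : ∀ σ, u σ ≤ v σ + C) : lse u ≤ lse v + C := by
  unfold lse
  have h1 : ∀ w : Λ → ℝ, 0 < ∑ σ, Real.exp (w σ) := fun w =>
    Finset.sum_pos (fun _ _ => Real.exp_pos _) Finset.univ_nonempty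
  rw [← Real.log_exp C, ← Real.log_mul (h1 v).ne' (Real.exp_pos _).ne']
  refine Real.log_le_log (h1 u) ?_
  rw [Finset.sum_mul]
  refine Finset.sum_le_sum fun σ _ => ?_
  rw [← Real.exp_add]
  exact Real.exp_le_exp.2 (h σ)

lemma lse_abs_sub {Λ : Type*} [Fintype Λ] [Nonempty Λ] (u v : Λ → ℝ) (C : ℝ)
    (h : ∀ σ, |u σ - v σ| ≤ C) : |lse u - lse v| ≤ C := by
  rw [abs_le]
  have h1 := lse_le_add u v C fun σ => by have := abs_le.1 (h σ); linarith
  have h2 := lse_le_add v u C fun σ => by have := abs_le.1 (h σ); linarith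
  constructor <;> linarith

lemma le_lse {Λ : Type*} [Fintype Λ] (u : Λ → ℝ) (σ : Λ) : u σ ≤ lse u := by
  unfold lse
  conv_lhs => rw [← Real.log_exp (u σ)]
  refine Real.log_le_log (Real.exp_pos _) ?_
  exact Finset.single_le_sum (f := fun σ => Real.exp (u σ)) (fun _ _ => (Real.exp_pos _).le)
    (Finset.mem_univ σ)

lemma lse_le {Λ : Type*} [Fintype Λ] [Nonempty Λ] (u : Λ → ℝ) (M : ℝ) (h : ∀ σ, u σ ≤ M) :
    lse u ≤ M + Real.log (Fintype.card Λ) := by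
  have := lse_le_add u (fun _ => 0) M (fun σ => by simpa using h σ)
  have e : lse (fun _ : Λ => (0 : ℝ)) = Real.log (Fintype.card Λ) := by simp [lse]
  rw [e] at this; linarith

/-- One step of the Lindeberg replacement. -/
lemma lindeberg_step {Λ Ω : Type*} [Fintype Λ] [Nonempty Λ] [MeasurableSpace Ω]
    (ν : Measure Ω) [IsProbabilityMeasure ν] (Z : Ω → ℝ) (hZm : Measurable Z)
    (hZ1 : Integrable Z ν) (hZ2 : Integrable (fun ω => Z ω ^ 2) ν)
    (hZ3 : Integrable (fun ω => |Z ω| ^ 3) ν)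
    (p : ℝ) (h0 : 0 ≤ p) (h1 : p ≤ 1)
    (m1 : ∫ ω, Z ω ∂ν = 0) (m2 : ∫ ω, Z ω ^ 2 ∂ν = p * (1 - p))
    (β : ℝ) (hβ : 0 ≤ β) (u s : Λ → ℝ) (hs : ∀ σ, s σ = 1 ∨ s σ = -1) :
    |((1 - p) * lse (fun σ => u σ + β * p * s σ) + p * lse (fun σ => u σ + β * (p - 1) * s σ))
      - ∫ ω, lse (fun σ => u σ + β * Z ω * s σ) ∂ν| ≤ 2 * β ^ 3 * (p + ∫ ω, |Z ω| ^ 3 ∂ν) := by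
  obtain ⟨c0, c1, c2, hc⟩ := lse_taylor u s hs
  have h1' : 0 ≤ 1 - p := by linarith
  have a1 := hc (β * p)
  have a2 := hc (β * (p - 1))
  have n1 : |β * p| ^ 3 = β ^ 3 * p ^ 3 := by
    rw [abs_of_nonneg (by positivity), mul_pow]
  have n2 : |β * (p - 1)| ^ 3 = β ^ 3 * (1 - p) ^ 3 := by
    rw [abs_mul, abs_of_nonneg hβ, abs_sub_comm, abs_of_nonneg h1', mul_pow]
  rw [n1] at a1
  rw [n2] at a2
  set L1 := lse (fun σ => u σ + β * p * s σ)
  set L2 := lse (fun σ => u σ + β * (p - 1) * s σ)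
  set q : Ω → ℝ := fun ω => c0 + c1 * (β * Z ω) + c2 * (β * Z ω) ^ 2 with hq
  have qe : q = fun ω => c0 + (c1 * β) * Z ω + (c2 * β ^ 2) * Z ω ^ 2 := by
    funext ω; simp only [hq]; ring
  have qi : Integrable q ν := by
    rw [qe]
    exact ((integrable_const _).add (hZ1.const_mul _)).add (hZ2.const_mul _)
  have qint : ∫ ω, q ω ∂ν = c0 + c2 * β ^ 2 * (p * (1 - p)) := by
    have i1 : Integrable (fun ω => c0 + (c1 * β) * Z ω) ν :=
      (integrable_const _).add (hZ1.const_mul _)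
    have i2 : Integrable (fun ω => (c2 * β ^ 2) * Z ω ^ 2) ν := hZ2.const_mul _
    have i3 : Integrable (fun ω => (c1 * β) * Z ω) ν := hZ1.const_mul _
    rw [qe, integral_add i1 i2, integral_add (integrable_const _) i3, integral_const_mul,
      integral_const_mul, m1, m2]
    simp
  have bnd : ∀ ω, |lse (fun σ => u σ + β * Z ω * s σ) - q ω| ≤ 2 * β ^ 3 * |Z ω| ^ 3 := by
    intro ω
    refine (hc (β * Z ω)).trans (le_of_eq ?_)
    rw [abs_mul, abs_of_nonneg hβ]; ring
  have lm : AEStronglyMeasurable (fun ω => lse (fun σ => u σ + β * Z ω * s σ)) ν := by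
    refine (Measurable.comp (g := lse) lse_continuous.measurable ?_).aestronglyMeasurable
    fun_prop
  have di : Integrable (fun ω => lse (fun σ => u σ + β * Z ω * s σ) - q ω) ν := by
    refine (hZ3.const_mul (2 * β ^ 3)).mono' (lm.sub qi.aestronglyMeasurable) ?_
    exact Eventually.of_forall bnd
  have di2 : |∫ ω, (lse (fun σ => u σ + β * Z ω * s σ) - q ω) ∂ν|
      ≤ 2 * β ^ 3 * ∫ ω, |Z ω| ^ 3 ∂ν := by
    rw [← integral_const_mul, ← Real.norm_eq_abs]
    exact norm_integral_le_of_norm_le (hZ3.const_mul _) (Eventually.of_forall bnd)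
  have li : Integrable (fun ω => lse (fun σ => u σ + β * Z ω * s σ)) ν := by
    have := di.add qi
    refine this.congr (Eventually.of_forall fun ω => ?_)
    simp
  rw [integral_sub li qi, qint] at di2
  set I := ∫ ω, lse (fun σ => u σ + β * Z ω * s σ) ∂ν
  set K3 := ∫ ω, |Z ω| ^ 3 ∂ν
  have k1 : |(1 - p) * (L1 - (c0 + c1 * (β * p) + c2 * (β * p) ^ 2))|
      ≤ (1 - p) * (2 * (β ^ 3 * p ^ 3)) := by
    rw [abs_mul, abs_of_nonneg h1']; gcongr
  have k2 : |p * (L2 - (c0 + c1 * (β * (p - 1)) + c2 * (β * (p - 1)) ^ 2))|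
      ≤ p * (2 * (β ^ 3 * (1 - p) ^ 3)) := by
    rw [abs_mul, abs_of_nonneg h0]; gcongr
  have k3 : (1 - p) * (2 * (β ^ 3 * p ^ 3)) + p * (2 * (β ^ 3 * (1 - p) ^ 3)) ≤ 2 * β ^ 3 * p := by
    have : (1 - p) * p ^ 3 + p * (1 - p) ^ 3 ≤ p := by
      have w1 : (1 - p) * p ^ 3 ≤ 1 * p ^ 2 := by
        refine mul_le_mul (by linarith) ?_ (by positivity) (by norm_num)
        exact pow_le_pow_of_le_one h0 h1 (by norm_num)
      have w2 : (1 - p) ^ 3 ≤ (1 - p) ^ 1 :=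
        pow_le_pow_of_le_one h1' (by linarith) (by norm_num)
      have w3 := mul_le_mul_of_nonneg_left w2 h0
      linarith
    have := mul_le_mul_of_nonneg_left this (show 0 ≤ 2 * β ^ 3 by positivity)
    linarith
  have e : ((1 - p) * L1 + p * L2) - I
      = (1 - p) * (L1 - (c0 + c1 * (β * p) + c2 * (β * p) ^ 2))
        + p * (L2 - (c0 + c1 * (β * (p - 1)) + c2 * (β * (p - 1)) ^ 2))
        - (I - (c0 + c2 * β ^ 2 * (p * (1 - p)))) := by ring
  rw [e]
  have t1 := abs_sub ((1 - p) * (L1 - (c0 + c1 * (β * p) + c2 * (β * p) ^ 2))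
        + p * (L2 - (c0 + c1 * (β * (p - 1)) + c2 * (β * (p - 1)) ^ 2)))
        (I - (c0 + c2 * β ^ 2 * (p * (1 - p))))
  have t2 := abs_add_le ((1 - p) * (L1 - (c0 + c1 * (β * p) + c2 * (β * p) ^ 2)))
        (p * (L2 - (c0 + c1 * (β * (p - 1)) + c2 * (β * (p - 1)) ^ 2)))
  linarith

lemma resample {κ : Type*} [Fintype κ] [DecidableEq κ] (μ : κ → Measure ℝ)
    [∀ i, IsProbabilityMeasure (μ i)] (a : κ) :
    MeasurePreserving (fun q : (κ → ℝ) × ℝ => Function.update q.1 a q.2)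
      ((Measure.pi μ).prod (μ a)) (Measure.pi μ) := by
  have hm : Measurable (fun q : (κ → ℝ) × ℝ => Function.update q.1 a q.2) := by
    rw [measurable_pi_iff]
    intro i
    by_cases h : i = a
    · subst h; simpa using measurable_snd
    · simp only [Function.update_of_ne h]
      exact (measurable_pi_apply i).comp measurable_fst
  refine ⟨hm, ?_⟩
  symm
  refine Measure.pi_eq fun s hs => ?_
  rw [Measure.map_apply hm (MeasurableSet.univ_pi hs)]
  have : (fun q : (κ → ℝ) × ℝ => Function.update q.1 a q.2) ⁻¹' (Set.univ.pi s)
      = (Set.univ.pi (Function.update s a Set.univ)) ×ˢ (s a) := by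
    ext q
    simp only [Set.mem_preimage, Set.mem_pi, Set.mem_univ, true_implies, Set.mem_prod]
    constructor
    · intro h
      refine ⟨fun i => ?_, by simpa using h a⟩
      by_cases hi : i = a
      · subst hi; simp
      · simpa [Function.update_of_ne hi] using h i
    · rintro ⟨h1, h2⟩ i
      by_cases hi : i = a
      · subst hi; simpa using h2
      · simpa [Function.update_of_ne hi] using h1 i
  rw [this, Measure.prod_prod, Measure.pi_pi,
    ← Finset.mul_prod_erase Finset.univ (fun i => μ i (s i)) (Finset.mem_univ a),
    ← Finset.mul_prod_erase Finset.univ _ (Finset.mem_univ a)]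
  simp only [Function.update_self, measure_univ, one_mul]
  rw [mul_comm]
  congr 1
  refine Finset.prod_congr rfl fun i hi => ?_
  rw [Function.update_of_ne (Finset.ne_of_mem_erase hi)]

instance (n : ℕ) : IsProbabilityMeasure (skMeasure n) := by
  unfold skMeasure; infer_instance

/-- standard Gaussian pair -/
noncomputable def gPair : Measure (ℝ × ℝ) :=
  (ProbabilityTheory.gaussianReal 0 1).prod (ProbabilityTheory.gaussianReal 0 1)

instance : IsProbabilityMeasure gPair := by unfold gPair; infer_instance

lemma gPair_map : Measure.map (fun q : ℝ × ℝ => q.1 + q.2) gPair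
    = ProbabilityTheory.gaussianReal 0 2 := by
  have := ProbabilityTheory.gaussianReal_conv_gaussianReal (m₁ := 0) (m₂ := 0) (v₁ := 1) (v₂ := 1)
  rw [Measure.conv] at this
  unfold gPair
  rw [this]
  norm_num

/-- third absolute moment -/
noncomputable def K3 : ℝ := ∫ x, |x| ^ 3 ∂(ProbabilityTheory.gaussianReal 0 2)

lemma gPair_int (f : ℝ → ℝ) (hf : Measurable f) :
    ∫ q : ℝ × ℝ, f (q.1 + q.2) ∂gPair = ∫ x, f x ∂(ProbabilityTheory.gaussianReal 0 2) := by
  rw [← gPair_map, integral_map (by fun_prop) hf.aestronglyMeasurable]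

lemma gPair_integrable (f : ℝ → ℝ) (hf : Measurable f)
    (h : Integrable f (ProbabilityTheory.gaussianReal 0 2)) :
    Integrable (fun q : ℝ × ℝ => f (q.1 + q.2)) gPair := by
  rw [← gPair_map, integrable_map_measure hf.aestronglyMeasurable (by fun_prop)] at h
  exact h

lemma g_int1 (v : NNReal) : Integrable (fun x : ℝ => x) (ProbabilityTheory.gaussianReal 0 v) := by
  have := (ProbabilityTheory.memLp_id_gaussianReal (μ := 0) (v := v) 1).integrable le_rfl
  exact this

lemma g_int2 (v : NNReal) :
    Integrable (fun x : ℝ => x ^ 2) (ProbabilityTheory.gaussianReal 0 v) := by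
  have := (ProbabilityTheory.memLp_id_gaussianReal (μ := 0) (v := v) 2).integrable_sq
  exact this

lemma g_int3 (v : NNReal) :
    Integrable (fun x : ℝ => |x| ^ 3) (ProbabilityTheory.gaussianReal 0 v) := by
  have := (ProbabilityTheory.memLp_id_gaussianReal (μ := 0) (v := v) 3).integrable_norm_pow
    (by norm_num)
  exact this

lemma g_m1 (v : NNReal) : ∫ x, x ∂(ProbabilityTheory.gaussianReal 0 v) = 0 := by
  simp [ProbabilityTheory.integral_id_gaussianReal]

lemma g_m2 (v : NNReal) : ∫ x, x ^ 2 ∂(ProbabilityTheory.gaussianReal 0 v) = v := by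
  have h := ProbabilityTheory.variance_id_gaussianReal (μ := 0) (v := v)
  rw [ProbabilityTheory.variance_of_integral_eq_zero (by fun_prop) (by simp)] at h
  simpa using h

lemma integrable_of_lin {n : ℕ} (F : (Fin n × Fin n → ℝ) → ℝ) (hF : Measurable F) (C0 C1 : ℝ)
    (h : ∀ J, |F J| ≤ C0 + C1 * ∑ e, |J e|) : Integrable F (skMeasure n) := by
  have h1 : ∀ e : Fin n × Fin n, Integrable (fun J : Fin n × Fin n → ℝ => |J e|) (skMeasure n) := by
    intro e
    have := (measurePreserving_eval (fun _ : Fin n × Fin n => ProbabilityTheory.gaussianReal 0 1) e)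
    exact this.integrable_comp_of_integrable (g_int1 1).abs
  have h2 : Integrable (fun J : Fin n × Fin n → ℝ => C0 + C1 * ∑ e, |J e|) (skMeasure n) :=
    (integrable_const _).add ((integrable_finsetSum _ fun e _ => h1 e).const_mul _)
  exact h2.mono' hF.aestronglyMeasurable (Eventually.of_forall h)

lemma lse_integrable {n : ℕ} {Λ : Type*} [Fintype Λ] [Nonempty Λ] (s : Fin n × Fin n → Λ → ℝ)
    (hs : ∀ e σ, s e σ = 1 ∨ s e σ = -1) (β c : ℝ) (S : Finset (Fin n × Fin n)) (u : Λ → ℝ) :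
    Measurable (fun J : Fin n × Fin n → ℝ =>
      lse (fun σ => u σ + β * ∑ e ∈ S, c * (J e + J e.swap) * s e σ)) ∧
    Integrable (fun J : Fin n × Fin n → ℝ =>
      lse (fun σ => u σ + β * ∑ e ∈ S, c * (J e + J e.swap) * s e σ)) (skMeasure n) := by
  have hm : Measurable (fun J : Fin n × Fin n → ℝ =>
      lse (fun σ => u σ + β * ∑ e ∈ S, c * (J e + J e.swap) * s e σ)) := by
    refine Measurable.comp (g := lse) lse_continuous.measurable ?_
    fun_prop
  refine ⟨hm, integrable_of_lin _ hm |lse u| (|β| * (S.card * (|c| * 2))) fun J => ?_⟩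
  set A := ∑ e, |J e| with hA
  have hle : ∀ e, |J e| ≤ A := fun e =>
    Finset.single_le_sum (f := fun e => |J e|) (fun _ _ => abs_nonneg _) (Finset.mem_univ e)
  have h1 := lse_abs_sub (fun σ => u σ + β * ∑ e ∈ S, c * (J e + J e.swap) * s e σ) u
    (|β| * (S.card * (|c| * 2)) * A) (fun σ => by
      rw [add_sub_cancel_left, abs_mul, mul_assoc]
      refine mul_le_mul_of_nonneg_left ?_ (abs_nonneg _)
      refine (Finset.abs_sum_le_sum_abs _ _).trans ?_
      have : (S.card : ℝ) * (|c| * 2) * A = ∑ e ∈ S, |c| * 2 * A := by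
        rw [Finset.sum_const, nsmul_eq_mul]; ring
      rw [this]
      refine Finset.sum_le_sum fun e _ => ?_
      have hs1 : |s e σ| = 1 := by rcases hs e σ with h | h <;> simp [h]
      rw [abs_mul, abs_mul, hs1, mul_one, mul_assoc]
      refine mul_le_mul_of_nonneg_left ?_ (abs_nonneg _)
      have := abs_add_le (J e) (J e.swap)
      linarith [hle e, hle e.swap])
  have := abs_sub_abs_le_abs_sub (lse (fun σ => u σ + β * ∑ e ∈ S, c * (J e + J e.swap) * s e σ))
    (lse u)
  linarith

lemma resample2 {n : ℕ} (a b : Fin n × Fin n) :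
    MeasurePreserving (fun q : (Fin n × Fin n → ℝ) × (ℝ × ℝ) =>
      Function.update (Function.update q.1 a q.2.1) b q.2.2)
      ((skMeasure n).prod gPair) (skMeasure n) := by
  have h1 := resample (fun _ : Fin n × Fin n => ProbabilityTheory.gaussianReal 0 1) a
  have h2 := resample (fun _ : Fin n × Fin n => ProbabilityTheory.gaussianReal 0 1) b
  have h3 := h1.prod (MeasurePreserving.id (ProbabilityTheory.gaussianReal 0 1))
  have h4 := (measurePreserving_prodAssoc (skMeasure n) (ProbabilityTheory.gaussianReal 0 1)
    (ProbabilityTheory.gaussianReal 0 1)).symm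
  exact h2.comp (h3.comp h4)

lemma lindeberg {n : ℕ} {Λ : Type*} [Fintype Λ] [Nonempty Λ] (s : Fin n × Fin n → Λ → ℝ)
    (hs : ∀ e σ, s e σ = 1 ∨ s e σ = -1) (p β c : ℝ) (h0 : 0 ≤ p) (h1 : p ≤ 1) (hβ : 0 ≤ β)
    (hc : 0 ≤ c) (hc2 : 2 * c ^ 2 = p * (1 - p)) (S : Finset (Fin n × Fin n)) :
    (∀ e ∈ S, e.1 < e.2) → ∀ u : Λ → ℝ,
    |bE p S (fun T => lse (fun σ => u σ + β * ∑ e ∈ S, (p - if e ∈ T then 1 else 0) * s e σ))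
      - ∫ J, lse (fun σ => u σ + β * ∑ e ∈ S, c * (J e + J e.swap) * s e σ) ∂(skMeasure n)|
      ≤ S.card * (2 * β ^ 3 * (p + c ^ 3 * K3)) := by
  induction S using Finset.induction_on with
  | empty => intro _ u; simp [bE_empty]
  | insert e S he ih =>
    intro hS u
    have hS' : ∀ e ∈ S, e.1 < e.2 := fun e' he' => hS e' (Finset.mem_insert_of_mem he')
    have hlt : e.1 < e.2 := hS e (Finset.mem_insert_self _ _)
    have hswap : e.swap ≠ e := fun h => by
      have := congrArg Prod.fst h
      simp only [Prod.fst_swap] at this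
      exact absurd hlt (by rw [this]; exact lt_irrefl _)
    have hswapS : ∀ e' ∈ S, e' ≠ e.swap ∧ e'.swap ≠ e ∧ e' ≠ e ∧ e'.swap ≠ e.swap := by
      intro e' he'
      have hl := hS' e' he'
      have hne : e' ≠ e := fun h => he (h ▸ he')
      refine ⟨fun h => ?_, fun h => ?_, hne, fun h => hne (Prod.swap_injective h)⟩
      · rw [h] at hl; exact absurd hlt (not_lt.2 hl.le)
      · rw [← h] at hlt; exact absurd hlt (not_lt.2 hl.le)
    set δ := 2 * β ^ 3 * (p + c ^ 3 * K3) with hδ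
    have i1 := ih hS' (fun σ => u σ + β * p * s e σ)
    have i2 := ih hS' (fun σ => u σ + β * (p - 1) * s e σ)
    -- Bernoulli side
    rw [bE_insert p S e he]
    have b1 : bE p S (fun T => lse (fun σ => u σ + β * ∑ e ∈ insert e S,
          (p - if e ∈ T then 1 else 0) * s e σ))
        = bE p S (fun T => lse (fun σ => u σ + β * p * s e σ + β * ∑ e ∈ S,
          (p - if e ∈ T then 1 else 0) * s e σ)) := by
      refine bE_congr S fun T hT => ?_
      congr 1; funext σ
      have : e ∉ T := fun h => he (hT h)
      rw [Finset.sum_insert he, if_neg this]; ring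
    have b2 : bE p S (fun T => lse (fun σ => u σ + β * ∑ e' ∈ insert e S,
          (p - if e' ∈ insert e T then 1 else 0) * s e' σ))
        = bE p S (fun T => lse (fun σ => u σ + β * (p - 1) * s e σ + β * ∑ e ∈ S,
          (p - if e ∈ T then 1 else 0) * s e σ)) := by
      refine bE_congr S fun T hT => ?_
      congr 1; funext σ
      rw [Finset.sum_insert he, if_pos (Finset.mem_insert_self _ _)]
      have : ∑ e' ∈ S, (p - if e' ∈ insert e T then 1 else 0) * s e' σ
          = ∑ e' ∈ S, (p - if e' ∈ T then 1 else 0) * s e' σ := by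
        refine Finset.sum_congr rfl fun e' he' => ?_
        have hne : e' ≠ e := fun h => he (h ▸ he')
        simp [Finset.mem_insert, hne]
      rw [this]; ring
    rw [b1, b2]
    -- Gaussian side
    set uJ : (Fin n × Fin n → ℝ) → Λ → ℝ :=
      fun J σ => u σ + β * ∑ e ∈ S, c * (J e + J e.swap) * s e σ with huJ
    set Z : ℝ × ℝ → ℝ := fun q => c * (q.1 + q.2) with hZ
    obtain ⟨fm, fi⟩ := lse_integrable s hs β c (insert e S) u
    have mp := resample2 (n := n) e e.swap
    have upd : ∀ q : (Fin n × Fin n → ℝ) × (ℝ × ℝ),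
        lse (fun σ => u σ + β * ∑ e' ∈ insert e S,
          c * (Function.update (Function.update q.1 e q.2.1) e.swap q.2.2 e'
            + Function.update (Function.update q.1 e q.2.1) e.swap q.2.2 e'.swap) * s e' σ)
        = lse (fun σ => uJ q.1 σ + β * Z q.2 * s e σ) := by
      intro q
      congr 1; funext σ
      rw [Finset.sum_insert he]
      have : ∑ e' ∈ S, c * (Function.update (Function.update q.1 e q.2.1) e.swap q.2.2 e'
            + Function.update (Function.update q.1 e q.2.1) e.swap q.2.2 e'.swap) * s e' σ
          = ∑ e' ∈ S, c * (q.1 e' + q.1 e'.swap) * s e' σ := by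
        refine Finset.sum_congr rfl fun e' he' => ?_
        obtain ⟨x1, x2, x3, x4⟩ := hswapS e' he'
        rw [Function.update_of_ne x1, Function.update_of_ne x3, Function.update_of_ne x4,
          Function.update_of_ne x2]
      rw [this, Function.update_self, Function.update_of_ne hswap.symm, Function.update_self]
      simp only [huJ, hZ]; ring
    have fi2 : Integrable (fun q : (Fin n × Fin n → ℝ) × (ℝ × ℝ) =>
        lse (fun σ => uJ q.1 σ + β * Z q.2 * s e σ)) ((skMeasure n).prod gPair) := by
      have := mp.integrable_comp_of_integrable fi
      refine this.congr (Eventually.of_forall fun q => ?_)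
      exact upd q
    have gI : ∫ J, lse (fun σ => u σ + β * ∑ e ∈ insert e S, c * (J e + J e.swap) * s e σ)
          ∂(skMeasure n)
        = ∫ J, (∫ q, lse (fun σ => uJ J σ + β * Z q * s e σ) ∂gPair) ∂(skMeasure n) := by
      rw [← integral_prod _ fi2]
      conv_lhs => rw [← mp.map_eq]
      rw [integral_map mp.measurable.aemeasurable fm.aestronglyMeasurable]
      exact integral_congr_ae (Eventually.of_forall upd)
    rw [gI]
    obtain ⟨-, l1⟩ := lse_integrable s hs β c S (fun σ => u σ + β * p * s e σ)
    obtain ⟨-, l2⟩ := lse_integrable s hs β c S (fun σ => u σ + β * (p - 1) * s e σ)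
    have r1 : ∀ x J, lse (fun σ => u σ + x * s e σ + β * ∑ e ∈ S, c * (J e + J e.swap) * s e σ)
        = lse (fun σ => uJ J σ + x * s e σ) := by
      intro x J; congr 1; funext σ; simp only [huJ]; ring
    simp only [r1] at l1 l2 i1 i2
    have l3 := fi2.integral_prod_left
    have hZm : Measurable Z := by fun_prop
    have z1 : Integrable Z gPair :=
      gPair_integrable (fun x => c * x) (by fun_prop) ((g_int1 2).const_mul c)
    have z2 : Integrable (fun q => Z q ^ 2) gPair := by
      have := gPair_integrable (fun x => (c * x) ^ 2) (by fun_prop) (by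
        simp only [mul_pow]; exact (g_int2 2).const_mul _)
      exact this
    have z3 : Integrable (fun q => |Z q| ^ 3) gPair := by
      have := gPair_integrable (fun x => |c * x| ^ 3) (by fun_prop) (by
        simp only [abs_mul, mul_pow]; exact (g_int3 2).const_mul _)
      exact this
    have m1 : ∫ q, Z q ∂gPair = 0 := by
      refine (gPair_int (fun x => c * x) (by fun_prop)).trans ?_
      rw [integral_const_mul, g_m1, mul_zero]
    have m2 : ∫ q, Z q ^ 2 ∂gPair = p * (1 - p) := by
      refine (gPair_int (fun x => (c * x) ^ 2) (by fun_prop)).trans ?_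
      simp only [mul_pow]
      rw [integral_const_mul, g_m2, ← hc2]
      push_cast; ring
    have m3 : ∫ q, |Z q| ^ 3 ∂gPair = c ^ 3 * K3 := by
      refine (gPair_int (fun x => |c * x| ^ 3) (by fun_prop)).trans ?_
      simp only [abs_mul, mul_pow, abs_of_nonneg hc]
      rw [integral_const_mul, K3]
    have step := fun J => lindeberg_step gPair Z hZm z1 z2 z3 p h0 h1 m1 m2 β hβ (uJ J) (s e) (hs e)
    rw [m3] at step
    have big : |∫ J, (((1 - p) * lse (fun σ => uJ J σ + β * p * s e σ)
        + p * lse (fun σ => uJ J σ + β * (p - 1) * s e σ))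
        - ∫ q, lse (fun σ => uJ J σ + β * Z q * s e σ) ∂gPair) ∂(skMeasure n)| ≤ δ := by
      rw [← Real.norm_eq_abs]
      refine (norm_integral_le_of_norm_le_const (C := δ) (Eventually.of_forall step)).trans ?_
      simp
    have l1' := l1.const_mul (1 - p)
    have l2' := l2.const_mul p
    rw [integral_sub (by exact l1'.add l2') l3, integral_add l1' l2', integral_const_mul,
      integral_const_mul] at big
    rw [Finset.card_insert_of_notMem he]
    push_cast
    have h1' : 0 ≤ 1 - p := by linarith
    rw [abs_le] at i1 i2 big ⊢
    constructor <;> nlinarith [mul_le_mul_of_nonneg_left i1.1 h1', mul_le_mul_of_nonneg_left i1.2 h1',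
      mul_le_mul_of_nonneg_left i2.1 h0, mul_le_mul_of_nonneg_left i2.2 h0]

/-- the index set of edges -/
def eSet (n : ℕ) : Finset (Fin n × Fin n) := Finset.univ.filter fun e => e.1 < e.2

/-- product of the spins at the two ends -/
noncomputable def sp {n : ℕ} (e : Fin n × Fin n) (σ : Fin n → Bool) : ℝ :=
  spin (σ e.1) * spin (σ e.2)

lemma spin_cases (b : Bool) : spin b = 1 ∨ spin b = -1 := by cases b <;> simp [spin]

lemma spin_sq (b : Bool) : spin b * spin b = 1 := by cases b <;> simp [spin]

lemma sp_cases {n : ℕ} (e : Fin n × Fin n) (σ : Fin n → Bool) : sp e σ = 1 ∨ sp e σ = -1 := by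
  unfold sp
  rcases spin_cases (σ e.1) with h | h <;> rcases spin_cases (σ e.2) with hb | hb <;>
    simp [h, hb]

/-- `max_σ (-∑_{e ∈ T} σ_e)` -/
noncomputable def Dmax (n : ℕ) (T : Finset (Fin n × Fin n)) : ℝ :=
  ⨆ σ : Fin n → Bool, -∑ e ∈ T, sp e σ

lemma le_sup {Λ : Type*} [Finite Λ] (u : Λ → ℝ) (σ : Λ) : u σ ≤ ⨆ σ, u σ :=
  le_ciSup (Set.finite_range u).bddAbove σ

lemma abs_sup_sub {Λ : Type*} [Finite Λ] [Nonempty Λ] (u v : Λ → ℝ) (C : ℝ)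
    (h : ∀ σ, |u σ - v σ| ≤ C) : |(⨆ σ, u σ) - ⨆ σ, v σ| ≤ C := by
  have h1 : (⨆ σ, u σ) ≤ (⨆ σ, v σ) + C := ciSup_le fun σ => by
    have := abs_le.1 (h σ); have := le_sup v σ; linarith
  have h2 : (⨆ σ, v σ) ≤ (⨆ σ, u σ) + C := ciSup_le fun σ => by
    have := abs_le.1 (h σ); have := le_sup u σ; linarith
  rw [abs_le]; constructor <;> linarith

lemma sup_add_const {Λ : Type*} [Finite Λ] [Nonempty Λ] (u : Λ → ℝ) (C : ℝ) :
    (⨆ σ, (u σ + C)) = (⨆ σ, u σ) + C := by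
  apply le_antisymm
  · exact ciSup_le fun σ => by have := le_sup u σ; linarith
  · have : (⨆ σ, u σ) ≤ (⨆ σ, (u σ + C)) - C := ciSup_le fun σ => by
      have := le_sup (fun σ => u σ + C) σ; linarith
    linarith

lemma Dmax_lip {n : ℕ} (T : Finset (Fin n × Fin n)) (e : Fin n × Fin n) :
    |Dmax n (insert e T) - Dmax n T| ≤ 1 := by
  by_cases he : e ∈ T
  · simp [Finset.insert_eq_of_mem he]
  refine abs_sup_sub _ _ 1 fun σ => ?_
  rw [Finset.sum_insert he]
  rcases sp_cases e σ with h | h <;> rw [h] <;> apply le_of_eq <;> ring_nf <;> simp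

/-- the Gaussian field -/
noncomputable def Y {n : ℕ} (c : ℝ) (J : Fin n × Fin n → ℝ) (σ : Fin n → Bool) : ℝ :=
  ∑ e ∈ eSet n, c * (J e + J e.swap) * sp e σ

/-- the mean term -/
noncomputable def wt {n : ℕ} (p : ℝ) (σ : Fin n → Bool) : ℝ := -p * ∑ e ∈ eSet n, sp e σ

lemma Y_abs {n : ℕ} (c : ℝ) (J : Fin n × Fin n → ℝ) (σ : Fin n → Bool) :
    |Y c J σ| ≤ ((eSet n).card * (|c| * 2)) * ∑ e, |J e| := by
  set A := ∑ e, |J e| with hA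
  have hle : ∀ e, |J e| ≤ A := fun e =>
    Finset.single_le_sum (f := fun e => |J e|) (fun _ _ => abs_nonneg _) (Finset.mem_univ e)
  refine (Finset.abs_sum_le_sum_abs _ _).trans ?_
  have : ((eSet n).card : ℝ) * (|c| * 2) * A = ∑ e ∈ eSet n, |c| * 2 * A := by
    rw [Finset.sum_const, nsmul_eq_mul]; ring
  rw [this]
  refine Finset.sum_le_sum fun e _ => ?_
  have hs1 : |sp e σ| = 1 := by rcases sp_cases e σ with h | h <;> simp [h]
  rw [abs_mul, abs_mul, hs1, mul_one, mul_assoc]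
  refine mul_le_mul_of_nonneg_left ?_ (abs_nonneg _)
  have := abs_add_le (J e) (J e.swap)
  linarith [hle e, hle e.swap]

lemma Y_meas {n : ℕ} (c : ℝ) (v : (Fin n → Bool) → ℝ) :
    Measurable (fun J : Fin n × Fin n → ℝ => ⨆ σ, (v σ + Y c J σ)) := by
  refine Measurable.iSup fun σ => ?_
  unfold Y
  fun_prop

lemma Y_integrable {n : ℕ} (c : ℝ) (v : (Fin n → Bool) → ℝ) :
    Integrable (fun J : Fin n × Fin n → ℝ => ⨆ σ, (v σ + Y c J σ)) (skMeasure n) := by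
  refine integrable_of_lin _ (Y_meas c v) |⨆ σ, v σ| ((eSet n).card * (|c| * 2)) fun J => ?_
  have := abs_sup_sub (fun σ => v σ + Y c J σ) v _ (fun σ => by
    rw [add_sub_cancel_left]; exact Y_abs c J σ)
  have h2 := abs_sub_abs_le_abs_sub (⨆ σ, (v σ + Y c J σ)) (⨆ σ, v σ)
  linarith

/-- gflip transformation -/
def gflip {n : ℕ} (τ σ : Fin n → Bool) : Fin n → Bool := fun i => τ i == σ i

lemma spin_beq (a b : Bool) : spin (a == b) = spin a * spin b := by
  cases a <;> cases b <;> simp [spin]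

lemma gauge_gauge {n : ℕ} (τ σ : Fin n → Bool) : gflip τ (gflip τ σ) = σ := by
  funext i; unfold gflip; cases τ i <;> cases σ i <;> rfl

lemma sp_gauge {n : ℕ} (e : Fin n × Fin n) (τ σ : Fin n → Bool) :
    sp e (gflip τ σ) = sp e τ * sp e σ := by
  unfold sp gflip; rw [spin_beq, spin_beq]; ring

/-- averaging over spins -/
lemma sum_sp {n : ℕ} (e : Fin n × Fin n) (he : e.1 ≠ e.2) :
    ∑ τ : Fin n → Bool, sp e τ = 0 := by
  have inv : ∀ τ : Fin n → Bool,
      Function.update (Function.update τ e.1 (!τ e.1)) e.1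
        (!(Function.update τ e.1 (!τ e.1)) e.1) = τ := by
    intro τ; simp
  have : ∑ τ : Fin n → Bool, sp e τ = ∑ τ : Fin n → Bool, -sp e τ := by
    refine Finset.sum_bij' (fun τ _ => Function.update τ e.1 (!τ e.1))
      (fun τ _ => Function.update τ e.1 (!τ e.1)) (by simp) (by simp)
      (fun τ _ => inv τ) (fun τ _ => inv τ) ?_
    intro τ _
    unfold sp
    rw [Function.update_self, Function.update_of_ne he.symm]
    cases τ e.1 <;> cases τ e.2 <;> simp [spin]
  rw [Finset.sum_neg_distrib] at this
  linarith

lemma sum_wt {n : ℕ} (p : ℝ) (σ : Fin n → Bool) : ∑ τ : Fin n → Bool, wt p (gflip τ σ) = 0 := by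
  unfold wt
  rw [← Finset.mul_sum, Finset.sum_comm]
  have : ∀ e ∈ eSet n, ∑ τ : Fin n → Bool, sp e (gflip τ σ) = 0 := by
    intro e he
    simp only [sp_gauge]
    rw [← Finset.sum_mul, sum_sp e (Finset.mem_filter.1 he).2.ne, zero_mul]
  rw [Finset.sum_eq_zero this, mul_zero]

lemma gauge_mp {n : ℕ} (τ : Fin n → Bool) :
    MeasurePreserving (fun (J : Fin n × Fin n → ℝ) e => sp e τ * J e)
      (skMeasure n) (skMeasure n) := by
  refine measurePreserving_pi _ _ fun e => ⟨by fun_prop, ?_⟩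
  rw [ProbabilityTheory.gaussianReal_map_const_mul]
  congr 1
  · simp
  · ext
    rcases sp_cases e τ with h | h <;> simp [h]

lemma sp_swap {n : ℕ} (e : Fin n × Fin n) (τ : Fin n → Bool) : sp e.swap τ = sp e τ := by
  simp [sp, mul_comm]

lemma Y_gauge {n : ℕ} (c : ℝ) (J : Fin n × Fin n → ℝ) (τ σ : Fin n → Bool) :
    Y c (fun e => sp e τ * J e) σ = Y c J (gflip τ σ) := by
  unfold Y
  refine Finset.sum_congr rfl fun e _ => ?_
  simp only [sp_gauge, sp_swap]; ring

lemma gauge_lower {n : ℕ} (c p : ℝ) :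
    ∫ J, (⨆ σ, Y c J σ) ∂(skMeasure n) ≤ ∫ J, (⨆ σ, (wt p σ + Y c J σ)) ∂(skMeasure n) := by
  have h1 : ∀ τ : Fin n → Bool, ∫ J, (⨆ σ, (wt p σ + Y c J σ)) ∂(skMeasure n)
      = ∫ J, (⨆ σ, (wt p (gflip τ σ) + Y c J σ)) ∂(skMeasure n) := by
    intro τ
    have mp := gauge_mp τ
    conv_lhs => rw [← mp.map_eq]
    rw [integral_map mp.measurable.aemeasurable (Y_meas c (wt p)).aestronglyMeasurable]
    refine integral_congr_ae (Eventually.of_forall fun J => ?_)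
    simp only [Y_gauge]
    let E : (Fin n → Bool) ≃ (Fin n → Bool) := ⟨gflip τ, gflip τ, gauge_gauge τ, gauge_gauge τ⟩
    have := Equiv.iSup_comp (g := fun σ => wt p (gflip τ σ) + Y c J σ) E
    rw [← this]
    refine iSup_congr fun σ => ?_
    change _ = wt p (gflip τ (gflip τ σ)) + Y c J (gflip τ σ)
    rw [gauge_gauge]
  set N : ℝ := (Fintype.card (Fin n → Bool) : ℝ) with hN
  have hNpos : 0 < N := by rw [hN]; exact_mod_cast Fintype.card_pos
  have h2 : N * ∫ J, (⨆ σ, (wt p σ + Y c J σ)) ∂(skMeasure n)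
      = ∫ J, ∑ τ : Fin n → Bool, (⨆ σ, (wt p (gflip τ σ) + Y c J σ)) ∂(skMeasure n) := by
    rw [integral_finsetSum _ fun τ _ => Y_integrable c (fun σ => wt p (gflip τ σ))]
    rw [← Finset.sum_congr rfl fun τ _ => h1 τ, Finset.sum_const, Finset.card_univ, nsmul_eq_mul]
  have h3 : N * ∫ J, (⨆ σ, Y c J σ) ∂(skMeasure n)
      ≤ ∫ J, ∑ τ : Fin n → Bool, (⨆ σ, (wt p (gflip τ σ) + Y c J σ)) ∂(skMeasure n) := by
    rw [← integral_const_mul]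
    refine integral_mono ?_ ?_ fun J => ?_
    · have := Y_integrable (n := n) c 0
      simp only [Pi.zero_apply, zero_add] at this
      exact this.const_mul _
    · exact integrable_finsetSum _ fun τ _ => Y_integrable c (fun σ => wt p (gflip τ σ))
    · simp only
      have : (⨆ σ, Y c J σ)
          ≤ N⁻¹ * ∑ τ : Fin n → Bool, (⨆ σ, (wt p (gflip τ σ) + Y c J σ)) := by
        refine ciSup_le fun σ => ?_
        rw [le_inv_mul_iff₀ hNpos]
        have e : N * Y c J σ = ∑ τ : Fin n → Bool, (wt p (gflip τ σ) + Y c J σ) := by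
          rw [Finset.sum_add_distrib, sum_wt, Finset.sum_const, Finset.card_univ, nsmul_eq_mul,
            zero_add]
        rw [e]
        exact Finset.sum_le_sum fun τ _ => le_sup (fun σ => wt p (gflip τ σ) + Y c J σ) σ
      rwa [le_inv_mul_iff₀ hNpos] at this
  rw [← h2] at h3
  exact le_of_mul_le_mul_left h3 hNpos

/-- splitting a double sum -/
lemma sum_pairs {n : ℕ} (f : Fin n × Fin n → ℝ) :
    ∑ e, f e = ∑ e ∈ eSet n, (f e + f e.swap) + ∑ i, f (i, i) := by
  have h1 : ∑ e, f e = ∑ e ∈ eSet n, f e + ∑ e ∈ Finset.univ.filter (fun e => ¬ e.1 < e.2), f e :=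
    (Finset.sum_filter_add_sum_filter_not _ _ _).symm
  have h2 : ∑ e ∈ Finset.univ.filter (fun e : Fin n × Fin n => ¬ e.1 < e.2), f e
      = ∑ e ∈ (Finset.univ.filter (fun e : Fin n × Fin n => ¬ e.1 < e.2)).filter
          (fun e => e.2 < e.1), f e
        + ∑ e ∈ (Finset.univ.filter (fun e : Fin n × Fin n => ¬ e.1 < e.2)).filter
          (fun e => ¬ e.2 < e.1), f e :=
    (Finset.sum_filter_add_sum_filter_not _ _ _).symm
  have h3 : ∑ e ∈ (Finset.univ.filter (fun e : Fin n × Fin n => ¬ e.1 < e.2)).filter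
          (fun e => e.2 < e.1), f e = ∑ e ∈ eSet n, f e.swap := by
    refine Finset.sum_bij' (fun e _ => e.swap) (fun e _ => e.swap) ?_ ?_ ?_ ?_ ?_
    · intro e he
      simp only [Finset.mem_filter, eSet, Finset.mem_univ, true_and] at he ⊢
      exact he.2
    · intro e he
      simp only [Finset.mem_filter, eSet, Finset.mem_univ, true_and] at he ⊢
      exact ⟨not_lt.2 he.le, he⟩
    · simp
    · simp
    · simp
  have h4 : ∑ e ∈ (Finset.univ.filter (fun e : Fin n × Fin n => ¬ e.1 < e.2)).filter
          (fun e => ¬ e.2 < e.1), f e = ∑ i, f (i, i) := by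
    refine Finset.sum_bij' (fun e _ => e.1) (fun i _ => (i, i)) ?_ ?_ ?_ ?_ ?_
    · simp
    · simp
    · rintro ⟨i, j⟩ he
      simp only [Finset.mem_filter, Finset.mem_univ, true_and] at he
      have : i = j := le_antisymm (not_lt.1 he.2) (not_lt.1 he.1)
      simp [this]
    · simp
    · rintro ⟨i, j⟩ he
      simp only [Finset.mem_filter, Finset.mem_univ, true_and] at he
      have : i = j := le_antisymm (not_lt.1 he.2) (not_lt.1 he.1)
      simp [this]
  rw [h1, h2, h3, h4, Finset.sum_add_distrib]; ring

lemma wt_le {n : ℕ} (p : ℝ) (h0 : 0 ≤ p) (σ : Fin n → Bool) : wt p σ ≤ p * n / 2 := by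
  have h := sum_pairs (fun e : Fin n × Fin n => sp e σ)
  have h1 : ∑ e : Fin n × Fin n, sp e σ = (∑ i, spin (σ i)) ^ 2 := by
    rw [Fintype.sum_prod_type, sq, Finset.sum_mul_sum]; rfl
  have h2 : ∑ i : Fin n, sp (i, i) σ = n := by simp [sp, spin_sq]
  rw [h1, h2] at h
  simp only [sp_swap] at h
  have h3 : ∑ e ∈ eSet n, (sp e σ + sp e σ) = 2 * ∑ e ∈ eSet n, sp e σ := by
    rw [Finset.mul_sum]; exact Finset.sum_congr rfl fun e _ => by ring
  rw [h3] at h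
  unfold wt
  have h4 : - ∑ e ∈ eSet n, sp e σ ≤ n / 2 := by nlinarith [sq_nonneg (∑ i, spin (σ i))]
  have := mul_le_mul_of_nonneg_left h4 h0
  linarith

lemma SK_eq {n : ℕ} (hn : 0 < n) (c : ℝ) (hc : 0 ≤ c) :
    ∫ J, (⨆ σ, Y c J σ) ∂(skMeasure n)
      = c * Real.sqrt (2 * n) * ∫ J, (⨆ σ : Fin n → Bool, -HSK n J σ) ∂(skMeasure n) := by
  have hsq : Real.sqrt (2 * n) ≠ 0 := by positivity
  rw [← integral_const_mul]
  have h1 : ∀ J : Fin n × Fin n → ℝ, c * Real.sqrt (2 * n) * (⨆ σ : Fin n → Bool, -HSK n J σ)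
      = (⨆ σ, Y c J σ) + c * ∑ i, J (i, i) := by
    intro J
    rw [Real.mul_iSup_of_nonneg (by positivity), ← sup_add_const]
    refine iSup_congr fun σ => ?_
    have h := sum_pairs (fun e : Fin n × Fin n => J e * spin (σ e.1) * spin (σ e.2))
    unfold HSK
    rw [h]
    have e1 : ∑ i : Fin n, J (i, i) * spin (σ i) * spin (σ i) = ∑ i, J (i, i) :=
      Finset.sum_congr rfl fun i _ => by rw [mul_assoc, spin_sq, mul_one]
    simp only
    rw [e1]
    have e2 : Y c J σ = c * ∑ e ∈ eSet n, (J e * spin (σ e.1) * spin (σ e.2) +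
      J e.swap * spin (σ e.swap.1) * spin (σ e.swap.2)) := by
      unfold Y
      rw [Finset.mul_sum]
      refine Finset.sum_congr rfl fun e _ => ?_
      simp only [sp, Prod.fst_swap, Prod.snd_swap]; ring
    rw [e2]
    field_simp
  rw [integral_congr_ae (Eventually.of_forall h1)]
  have hYi := Y_integrable (n := n) c 0
  simp only [Pi.zero_apply, zero_add] at hYi
  have h2 : ∀ e : Fin n × Fin n, Integrable (fun J : Fin n × Fin n → ℝ => J e) (skMeasure n) := by
    intro e
    have := (measurePreserving_eval (fun _ : Fin n × Fin n => ProbabilityTheory.gaussianReal 0 1) e)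
    exact this.integrable_comp_of_integrable (g_int1 1)
  have h3 : ∀ e : Fin n × Fin n, ∫ J, J e ∂(skMeasure n) = 0 := by
    intro e
    have mp := (measurePreserving_eval (fun _ : Fin n × Fin n =>
      ProbabilityTheory.gaussianReal 0 1) e)
    have := integral_map (μ := skMeasure n) (φ := Function.eval e) mp.measurable.aemeasurable
      (f := fun x : ℝ => x) (by fun_prop)
    refine this.symm.trans ?_
    have h4 := mp.map_eq
    unfold skMeasure
    rw [h4, g_m1]
  have h5 : Integrable (fun J : Fin n × Fin n → ℝ => c * ∑ i, J (i, i)) (skMeasure n) :=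
    (integrable_finsetSum _ fun i _ => h2 (i, i)).const_mul _
  rw [integral_add hYi h5, integral_const_mul, integral_finsetSum _ fun i _ => h2 (i, i)]
  simp [h3]

lemma Dmax_eq {n : ℕ} (p : ℝ) (T : Finset (Fin n × Fin n)) (hT : T ⊆ eSet n) :
    Dmax n T = ⨆ σ, (wt p σ + ∑ e ∈ eSet n, (p - if e ∈ T then 1 else 0) * sp e σ) := by
  refine iSup_congr fun σ => ?_
  have : ∑ e ∈ T, sp e σ = ∑ e ∈ eSet n, (if e ∈ T then 1 else 0) * sp e σ := by
    simp only [ite_mul, one_mul, zero_mul]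
    rw [← Finset.sum_filter, Finset.filter_mem_eq_inter, Finset.inter_eq_right.2 hT]
  rw [this]
  unfold wt
  simp only [sub_mul]
  rw [Finset.sum_sub_distrib, ← Finset.mul_sum]; ring

lemma lse_sup_bounds {n : ℕ} (β : ℝ) (hβ : 0 < β) (u : (Fin n → Bool) → ℝ) :
    β * (⨆ σ, u σ) ≤ lse (fun σ => β * u σ) ∧
    lse (fun σ => β * u σ) ≤ β * (⨆ σ, u σ) + n * Real.log 2 := by
  constructor
  · rw [Real.mul_iSup_of_nonneg hβ.le]
    exact ciSup_le fun σ => le_lse (fun σ => β * u σ) σ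
  · have := lse_le (fun σ => β * u σ) (β * ⨆ σ, u σ) fun σ =>
      mul_le_mul_of_nonneg_left (le_sup u σ) hβ.le
    simpa using this

lemma mean_compare {n : ℕ} (hn : 0 < n) (p β c : ℝ) (h0 : 0 ≤ p) (h1 : p ≤ 1) (hβ : 0 < β)
    (hc : 0 ≤ c) (hc2 : 2 * c ^ 2 = p * (1 - p)) :
    |bE p (eSet n) (Dmax n)
      - c * Real.sqrt (2 * n) * ∫ J, (⨆ σ : Fin n → Bool, -HSK n J σ) ∂(skMeasure n)|
      ≤ n * Real.log 2 / β + (eSet n).card * (2 * β ^ 2 * (p + c ^ 3 * K3)) + p * n / 2 := by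
  rw [← SK_eq hn c hc]
  have hl := lindeberg (sp (n := n)) sp_cases p β c h0 h1 hβ.le hc hc2 (eSet n)
    (fun e he => (Finset.mem_filter.1 he).2) (fun σ => β * wt p σ)
  set I1 := ∫ J, (⨆ σ, Y c J σ) ∂(skMeasure n) with hI1
  set I2 := ∫ J, (⨆ σ, (wt p σ + Y c J σ)) ∂(skMeasure n) with hI2
  have g1 : I1 ≤ I2 := gauge_lower c p
  have Yi := Y_integrable (n := n) c 0
  simp only [Pi.zero_apply, zero_add] at Yi
  have g2 : I2 ≤ I1 + p * n / 2 := by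
    have : I1 + p * n / 2 = ∫ J, ((⨆ σ, Y c J σ) + p * n / 2) ∂(skMeasure n) := by
      rw [integral_add Yi (integrable_const _)]; simp [hI1]
    rw [this]
    refine integral_mono (Y_integrable c (wt p)) (Yi.add (integrable_const _)) fun J => ?_
    refine ciSup_le fun σ => ?_
    have := wt_le p h0 σ
    have := le_sup (Y c J) σ
    simp only
    linarith
  -- lse of the gaussian
  have r1 : ∀ J : Fin n × Fin n → ℝ, (fun σ => β * wt p σ + β * ∑ e ∈ eSet n,
      c * (J e + J e.swap) * sp e σ) = fun σ => β * (wt p σ + Y c J σ) := by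
    intro J; funext σ; unfold Y; ring
  have li := (lse_integrable (sp (n := n)) sp_cases β c (eSet n) (fun σ => β * wt p σ)).2
  simp only [r1] at hl li
  have Wi := Y_integrable (n := n) c (wt p)
  set L := ∫ J, lse (fun σ => β * (wt p σ + Y c J σ)) ∂(skMeasure n) with hL
  have g3 : β * I2 ≤ L := by
    rw [hI2, ← integral_const_mul]
    exact integral_mono (Wi.const_mul _) li fun J => (lse_sup_bounds β hβ _).1
  have g4 : L ≤ β * I2 + n * Real.log 2 := by
    have : β * I2 + n * Real.log 2
        = ∫ J, (β * (⨆ σ, (wt p σ + Y c J σ)) + n * Real.log 2) ∂(skMeasure n) := by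
      rw [integral_add (Wi.const_mul _) (integrable_const _), integral_const_mul]; simp [hI2]
    rw [this]
    exact integral_mono li ((Wi.const_mul _).add (integrable_const _))
      fun J => (lse_sup_bounds β hβ _).2
  -- Bernoulli side
  have r2 : ∀ T : Finset (Fin n × Fin n), (fun σ => β * wt p σ + β * ∑ e ∈ eSet n,
      (p - if e ∈ T then 1 else 0) * sp e σ)
      = fun σ => β * (wt p σ + ∑ e ∈ eSet n, (p - if e ∈ T then 1 else 0) * sp e σ) := by
    intro T; funext σ; ring
  simp only [r2] at hl
  set B := bE p (eSet n) (fun T => lse (fun σ => β * (wt p σ + ∑ e ∈ eSet n,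
    (p - if e ∈ T then 1 else 0) * sp e σ))) with hB
  have g5 : β * bE p (eSet n) (Dmax n) ≤ B := by
    rw [← bE_smul]
    refine bE_mono h0 h1 _ fun T hT => ?_
    rw [Dmax_eq p T hT]
    exact (lse_sup_bounds β hβ _).1
  have g6 : B ≤ β * bE p (eSet n) (Dmax n) + n * Real.log 2 := by
    rw [← bE_smul, ← bE_const p (n * Real.log 2) (eSet n), ← bE_add]
    refine bE_mono h0 h1 _ fun T hT => ?_
    rw [Dmax_eq p T hT]
    exact (lse_sup_bounds β hβ _).2
  set b := bE p (eSet n) (Dmax n)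
  set N : ℝ := ((eSet n).card : ℝ)
  have hl' := abs_le.1 hl
  have key : |b - I2| ≤ n * Real.log 2 / β + N * (2 * β ^ 2 * (p + c ^ 3 * K3)) := by
    have e : n * Real.log 2 / β + N * (2 * β ^ 2 * (p + c ^ 3 * K3))
      = (n * Real.log 2 + N * (2 * β ^ 3 * (p + c ^ 3 * K3))) / β := by field_simp
    rw [e, le_div_iff₀ hβ, ← abs_of_pos hβ, ← abs_mul, abs_of_pos hβ, abs_le]
    constructor <;> linarith
  have : |I2 - I1| ≤ p * n / 2 := by rw [abs_le]; constructor <;> [skip; skip] <;> nlinarith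
  have := abs_sub_le b I2 I1
  linarith

open Classical in
/-- the set of ordered edges of a graph -/
noncomputable def gEdges {n : ℕ} (G : SimpleGraph (Fin n)) : Finset (Fin n × Fin n) :=
  (eSet n).filter fun e => G.Adj e.1 e.2

lemma mem_gEdges {n : ℕ} (G : SimpleGraph (Fin n)) (e : Fin n × Fin n) :
    e ∈ gEdges G ↔ e.1 < e.2 ∧ G.Adj e.1 e.2 := by
  simp [gEdges, eSet]

lemma gEdges_subset {n : ℕ} (G : SimpleGraph (Fin n)) : gEdges G ⊆ eSet n :=
  fun e he => by rw [mem_gEdges] at he; simp [eSet, he.1]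

lemma gEdges_injective {n : ℕ} :
    Function.Injective (gEdges : SimpleGraph (Fin n) → Finset (Fin n × Fin n)) := by
  intro G H h
  have key : ∀ i j, i < j → (G.Adj i j ↔ H.Adj i j) := by
    intro i j hij
    have h1 := mem_gEdges G (i, j)
    have h2 := mem_gEdges H (i, j)
    rw [h] at h1
    simp only [hij, true_and] at h1 h2
    rw [← h1, h2]
  ext i j
  rcases lt_trichotomy i j with hij | hij | hij
  · exact key i j hij
  · subst hij; simp
  · rw [G.adj_comm, H.adj_comm]; exact key j i hij

lemma gEdges_surj {n : ℕ} (T : Finset (Fin n × Fin n)) (hT : T ⊆ eSet n) :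
    ∃ G : SimpleGraph (Fin n), gEdges G = T := by
  refine ⟨SimpleGraph.fromRel fun i j => (i, j) ∈ T, ?_⟩
  ext ⟨i, j⟩
  rw [mem_gEdges, SimpleGraph.fromRel_adj]
  constructor
  · rintro ⟨h1, -, h2 | h2⟩
    · exact h2
    · have := (Finset.mem_filter.1 (hT h2)).2
      exact absurd h1 (not_lt.2 this.le)
  · intro h
    have := (Finset.mem_filter.1 (hT h)).2
    exact ⟨this, this.ne, Or.inl h⟩

lemma edgeSet_ncard {n : ℕ} (G : SimpleGraph (Fin n)) :
    G.edgeSet.ncard = (gEdges G).card := by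
  have h1 : G.edgeSet = (fun e : Fin n × Fin n => s(e.1, e.2)) '' (gEdges G : Set (Fin n × Fin n)) := by
    ext x
    induction x using Sym2.ind with
    | _ i j =>
      simp only [SimpleGraph.mem_edgeSet, Set.mem_image, Finset.mem_coe, mem_gEdges]
      constructor
      · intro h
        rcases lt_trichotomy i j with hij | hij | hij
        · exact ⟨(i, j), ⟨hij, h⟩, rfl⟩
        · subst hij; exact absurd h (G.irrefl)
        · exact ⟨(j, i), ⟨hij, h.symm⟩, Sym2.eq_swap⟩
      · rintro ⟨e, ⟨-, h⟩, he⟩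
        have : s(e.1, e.2) ∈ G.edgeSet := h
        rw [he] at this
        exact this
  rw [h1, Set.ncard_image_of_injOn, Set.ncard_coe_finset]
  rintro ⟨a, b⟩ ha ⟨c, d⟩ hc h
  have ha' := ((mem_gEdges G _).1 (Finset.mem_coe.1 ha)).1
  have hc' := ((mem_gEdges G _).1 (Finset.mem_coe.1 hc)).1
  simp only at ha' hc'
  rcases Sym2.eq_iff.1 h with ⟨h1, h2⟩ | ⟨h1, h2⟩
  · simp only at h1 h2; rw [h1, h2]
  · simp only at h1 h2
    subst h1 h2
    exact absurd ha' (not_lt.2 hc'.le)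

lemma cutSize_eq {n : ℕ} (G : SimpleGraph (Fin n)) (S : Finset (Fin n)) (σ : Fin n → Bool)
    (hσ : ∀ i, i ∈ S ↔ σ i = true) :
    (cutSize G S : ℝ) = ((gEdges G).card - ∑ e ∈ gEdges G, sp e σ) / 2 := by
  classical
  set f : Fin n × Fin n → ℝ := fun e =>
    if e.1 ∈ S then (if e.2 ∈ Sᶜ then (if G.Adj e.1 e.2 then 1 else 0) else 0) else 0 with hf
  have h1 : (cutSize G S : ℝ) = ∑ e, f e := by
    unfold cutSize
    push_cast
    rw [Fintype.sum_prod_type, ← Finset.sum_filter_add_sum_filter_not Finset.univ (fun i => i ∈ S)]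
    have z : ∑ i ∈ Finset.univ.filter (fun i => i ∉ S), ∑ j, f (i, j) = 0 := by
      refine Finset.sum_eq_zero fun i hi => Finset.sum_eq_zero fun j _ => ?_
      simp only [hf, if_neg (Finset.mem_filter.1 hi).2]
    rw [z, add_zero]
    have : Finset.univ.filter (fun i => i ∈ S) = S := by ext; simp
    rw [this]
    refine Finset.sum_congr rfl fun i hi => ?_
    simp only [hf, if_pos hi]
    rw [Finset.sum_ite_mem, Finset.univ_inter]
    try refine Finset.sum_congr rfl fun j _ => by split_ifs <;> simp
  have h2 : ∑ i, f (i, i) = 0 := Finset.sum_eq_zero fun i _ => by simp [hf]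
  rw [h1, sum_pairs, h2, add_zero]
  have h3 : (((gEdges G).card : ℝ) - ∑ e ∈ gEdges G, sp e σ) / 2
      = ∑ e ∈ gEdges G, (1 - sp e σ) / 2 := by
    rw [← Finset.sum_div, Finset.sum_sub_distrib]; simp
  rw [h3]
  unfold gEdges
  rw [Finset.sum_filter]
  refine Finset.sum_congr rfl fun e _ => ?_
  simp only [hf, Prod.fst_swap, Prod.snd_swap, Finset.mem_compl, hσ, G.adj_comm e.2 e.1, sp]
  by_cases ha : G.Adj e.1 e.2
  · cases σ e.1 <;> cases σ e.2 <;> simp [ha, spin] <;> norm_num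
  · simp [ha]

lemma MaxCut_eq {n : ℕ} (G : SimpleGraph (Fin n)) :
    (MaxCut G : ℝ) = ((gEdges G).card + Dmax n (gEdges G)) / 2 := by
  classical
  have hfin : {k : ℕ | ∃ S : Finset (Fin n), cutSize G S = k}.Finite :=
    Set.finite_range (fun S => cutSize G S)
  have hne : {k : ℕ | ∃ S : Finset (Fin n), cutSize G S = k}.Nonempty := ⟨_, ∅, rfl⟩
  apply le_antisymm
  · obtain ⟨S, hS⟩ := Nat.sSup_mem hne hfin.bddAbove
    have hS' : cutSize G S = MaxCut G := hS
    rw [← hS', cutSize_eq G S (fun i => decide (i ∈ S)) (fun i => by simp)]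
    have := le_sup (fun σ : Fin n → Bool => -∑ e ∈ gEdges G, sp e σ) (fun i => decide (i ∈ S))
    simp only [Dmax]
    linarith
  · have : Dmax n (gEdges G) ≤ 2 * MaxCut G - (gEdges G).card := by
      refine ciSup_le fun σ => ?_
      have h1 : cutSize G (Finset.univ.filter fun i => σ i = true) ≤ MaxCut G :=
        le_csSup hfin.bddAbove ⟨_, rfl⟩
      have h2 : (cutSize G (Finset.univ.filter fun i => σ i = true) : ℝ) ≤ MaxCut G := by
        exact_mod_cast h1
      rw [cutSize_eq G _ σ (fun i => by simp)] at h2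
      linarith
    linarith

lemma prob_bound {n m : ℕ} (hm : m ≤ (eSet n).card) (B : Set (SimpleGraph (Fin n)))
    (F : Finset (Fin n × Fin n) → ℝ) (hF : ∀ T, 0 ≤ F T) (t : ℝ) (ht : 0 < t)
    (h : ∀ G : SimpleGraph (Fin n), (gEdges G).card = m → G ∉ B → t ≤ F (gEdges G)) :
    1 - uE m (eSet n) F / t ≤ probUniform {G : SimpleGraph (Fin n) | G.edgeSet.ncard = m} B ∧
    probUniform {G : SimpleGraph (Fin n) | G.edgeSet.ncard = m} B ≤ 1 := by
  classical
  set A := {G : SimpleGraph (Fin n) | G.edgeSet.ncard = m} with hA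
  have hAfin : A.Finite := Set.toFinite A
  have c1 : A.ncard = (eSet n).card.choose m := by
    rw [← Finset.card_powersetCard, ← Set.ncard_coe_finset, ← Set.ncard_image_of_injective A
      gEdges_injective]
    congr 1
    ext T
    simp only [Set.mem_image, hA, Set.mem_setOf_eq, Finset.mem_coe, Finset.mem_powersetCard]
    constructor
    · rintro ⟨G, hG, rfl⟩
      exact ⟨gEdges_subset G, by rw [← edgeSet_ncard, hG]⟩
    · rintro ⟨h1, h2⟩
      obtain ⟨G, rfl⟩ := gEdges_surj T h1
      exact ⟨G, by rw [edgeSet_ncard, h2], rfl⟩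
  have cpos : 0 < ((eSet n).card.choose m : ℝ) := by exact_mod_cast Nat.choose_pos hm
  have c2 : (A ∩ B).ncard + (A \ B).ncard = A.ncard := Set.ncard_inter_add_ncard_diff_eq_ncard A B
  have c3 : ((A \ B).ncard : ℝ) * t ≤ ∑ T ∈ (eSet n).powersetCard m, F T := by
    have h1 : (A \ B).ncard ≤ (((eSet n).powersetCard m).filter fun T => t ≤ F T).card := by
      rw [← Set.ncard_image_of_injective (A \ B) gEdges_injective, ← Set.ncard_coe_finset]
      refine Set.ncard_le_ncard ?_ (Finset.finite_toSet _)
      rintro T ⟨G, ⟨hG1, hG2⟩, rfl⟩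
      have hc : (gEdges G).card = m := by rw [← edgeSet_ncard]; exact hG1
      simp only [Finset.mem_coe, Finset.mem_filter, Finset.mem_powersetCard]
      exact ⟨⟨gEdges_subset G, hc⟩, h G hc hG2⟩
    calc ((A \ B).ncard : ℝ) * t
        ≤ ((((eSet n).powersetCard m).filter fun T => t ≤ F T).card : ℝ) * t := by
          gcongr
      _ = ∑ T ∈ ((eSet n).powersetCard m).filter (fun T => t ≤ F T), t := by
          rw [Finset.sum_const, nsmul_eq_mul]
      _ ≤ ∑ T ∈ ((eSet n).powersetCard m).filter (fun T => t ≤ F T), F T :=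
          Finset.sum_le_sum fun T hT => (Finset.mem_filter.1 hT).2
      _ ≤ _ := Finset.sum_le_sum_of_subset_of_nonneg (Finset.filter_subset _ _)
          fun T _ _ => hF T
  have c2' : ((A ∩ B).ncard : ℝ) + (A \ B).ncard = (eSet n).card.choose m := by
    rw [← c1]; exact_mod_cast c2
  unfold probUniform uE
  rw [c1]
  constructor
  · rw [le_div_iff₀ cpos, sub_mul, one_mul, ← c2']
    have : (A \ B).ncard ≤ (∑ T ∈ (eSet n).powersetCard m, F T) / ((eSet n).card.choose m) / t
        * ((eSet n).card.choose m) := by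
      have e : (∑ T ∈ (eSet n).powersetCard m, F T) / ((eSet n).card.choose m : ℝ) / t
        * ((eSet n).card.choose m) = (∑ T ∈ (eSet n).powersetCard m, F T) / t := by
        field_simp
      rw [e, le_div_iff₀ ht]; exact c3
    rw [c2']
    linarith
  · rw [div_le_one cpos, ← c2']
    have : (0 : ℝ) ≤ (A \ B).ncard := by positivity
    linarith

lemma eSet_card (n : ℕ) : ((eSet n).card : ℝ) = n * (n - 1) / 2 := by
  have := sum_pairs (fun _ : Fin n × Fin n => (1 : ℝ))
  simp at this
  linarith

lemma K3_nonneg : 0 ≤ K3 := integral_nonneg fun x => by positivity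

set_option maxHeartbeats 2000000 in
lemma final_bound {ε γ L : ℝ} (hε : 0 < ε) (hγ : 1 ≤ γ) (hL : 0 < L)
    (hL1 : L = Real.log 2 * 4 / ε) (hL2 : 8 * L ^ 2 * (1 + K3) / ε ≤ √γ)
    {n : ℕ} (hn : 2 * γ + 1 ≤ n) (Pstar M : ℝ)
    (hM : M = ∫ J, (⨆ σ : Fin n → Bool, -HSK n J σ) ∂(skMeasure n))
    (h1 : (1 + γ) / n ≤ ε * √γ / 4)
    (h2 : |√(2 * γ * (1 - 2 * γ / n)) * ((n : ℝ)⁻¹ * M) - √(2 * γ) * Pstar| ≤ ε * √γ / 4) :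
    1 - (2 * √(γ * n) + (γ + 1)) / (ε * √γ * n) ≤
      probUniform {G : SimpleGraph (Fin n) | G.edgeSet.ncard = ⌊γ * n⌋₊}
            {G : SimpleGraph (Fin n) |
              |(MaxCut G : ℝ) / n - (γ / 2 + Pstar * Real.sqrt (γ / 2))|
                ≤ ε * Real.sqrt γ} ∧
      probUniform {G : SimpleGraph (Fin n) | G.edgeSet.ncard = ⌊γ * n⌋₊}
            {G : SimpleGraph (Fin n) |
              |(MaxCut G : ℝ) / n - (γ / 2 + Pstar * Real.sqrt (γ / 2))|
                ≤ ε * Real.sqrt γ} ≤ 1 := by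
  have hnpos : (0 : ℝ) < n := by linarith
  have hn0 : 0 < n := by exact_mod_cast hnpos
  have hs : 0 < √γ := Real.sqrt_pos.2 (by linarith)
  have hss : √γ * √γ = γ := Real.mul_self_sqrt (by linarith)
  have hK := K3_nonneg
  set m := ⌊γ * n⌋₊ with hm
  have hm1 : (m : ℝ) ≤ γ * n := Nat.floor_le (by positivity)
  have hm2 : γ * n < m + 1 := Nat.lt_floor_add_one _
  obtain ⟨p, hp⟩ : ∃ p : ℝ, p = 2 * γ / n := ⟨_, rfl⟩
  have hpn : p * n = 2 * γ := by rw [hp]; field_simp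
  have hp0 : 0 ≤ p := by rw [hp]; positivity
  have hp1 : p ≤ 1 := by rw [hp, div_le_one hnpos]; linarith
  have hN : ((eSet n).card : ℝ) = n * (n - 1) / 2 := eSet_card n
  have hNp : ((eSet n).card : ℝ) * p = (n - 1) * γ := by
    rw [hN]; linear_combination (n - 1 : ℝ) / 2 * hpn
  have hmN : m ≤ (eSet n).card := by
    have : (m : ℝ) ≤ (eSet n).card := by
      rw [hN]; nlinarith
    exact_mod_cast this
  obtain ⟨c, hc⟩ : ∃ c : ℝ, c = √(p * (1 - p) / 2) := ⟨_, rfl⟩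
  have hpp : 0 ≤ p * (1 - p) := mul_nonneg hp0 (by linarith)
  have hc0 : 0 ≤ c := by rw [hc]; positivity
  have hc2 : 2 * c ^ 2 = p * (1 - p) := by
    rw [hc, Real.sq_sqrt (by linarith)]; ring
  have hc2p : c ^ 2 ≤ p := by nlinarith
  have hc1 : c ≤ 1 := by nlinarith
  have hc3 : c ^ 3 ≤ p := by
    calc c ^ 3 = c ^ 2 * c := by ring
      _ ≤ c ^ 2 * 1 := by gcongr
      _ ≤ p := by linarith
  have hβ : 0 < L / √γ := by positivity
  have hmc := mean_compare hn0 p (L / √γ) c hp0 hp1 hβ hc0 hc2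
  rw [← hM] at hmc
  have hcs : c * √(2 * n) = √(2 * γ * (1 - 2 * γ / n)) := by
    rw [hc, ← Real.sqrt_mul (by linarith), ← hp]
    congr 1
    linear_combination (1 - p) * hpn
  rw [hcs] at hmc
  set A := bE p (eSet n) (Dmax n) with hA
  set r := √(2 * γ * (1 - 2 * γ / n)) with hr
  have hdev := uE_dev hp0 hp1 (eSet n) (Dmax n) (fun T _ e _ => Dmax_lip T e) m hmN
  rw [← hA] at hdev
  have ht : 0 < ε * √γ * n := by positivity
  -- the error terms
  have e1 : (n : ℝ) * Real.log 2 / (L / √γ) = ε * √γ / 4 * n := by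
    have hl : Real.log 2 ≠ 0 := (Real.log_pos (by norm_num)).ne'
    rw [hL1]; field_simp
  have e2 : ((eSet n).card : ℝ) * (2 * (L / √γ) ^ 2 * (p + c ^ 3 * K3)) ≤ ε * √γ / 4 * n := by
    have hb : (L / √γ) ^ 2 * γ = L ^ 2 := by
      rw [div_pow, Real.sq_sqrt (by linarith)]; field_simp
    have hq : 8 * L ^ 2 * (1 + K3) ≤ √γ * ε := by rwa [div_le_iff₀ hε] at hL2
    calc ((eSet n).card : ℝ) * (2 * (L / √γ) ^ 2 * (p + c ^ 3 * K3))
        ≤ ((eSet n).card : ℝ) * (2 * (L / √γ) ^ 2 * (p + p * K3)) := by gcongr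
      _ = 2 * (L / √γ) ^ 2 * (1 + K3) * (((eSet n).card : ℝ) * p) := by ring
      _ = 2 * ((L / √γ) ^ 2 * γ) * (1 + K3) * (n - 1) := by rw [hNp]; ring
      _ = 2 * L ^ 2 * (1 + K3) * (n - 1) := by rw [hb]
      _ ≤ 2 * L ^ 2 * (1 + K3) * n := by gcongr; linarith
      _ ≤ ε * √γ / 4 * n := by gcongr; linarith
  have e3 : p * n / 2 = γ := by rw [hpn]; ring
  rw [e1, e3] at hmc
  have h1' : 1 + γ ≤ ε * √γ / 4 * n := by rwa [div_le_iff₀ hnpos] at h1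
  have hsq : √(2 * γ) = 2 * √(γ / 2) := by
    rw [show 2 * γ = 2 ^ 2 * (γ / 2) by ring, Real.sqrt_mul (by norm_num),
      Real.sqrt_sq (by norm_num)]
  have h2' : |r * M - 2 * √(γ / 2) * Pstar * n| ≤ ε * √γ / 4 * n := by
    have : r * M - 2 * √(γ / 2) * Pstar * n
        = (r * ((n : ℝ)⁻¹ * M) - √(2 * γ) * Pstar) * n := by
      rw [hsq]; field_simp
    rw [this, abs_mul, abs_of_pos hnpos]
    gcongr
  have hb := prob_bound hmN {G : SimpleGraph (Fin n) |
              |(MaxCut G : ℝ) / n - (γ / 2 + Pstar * Real.sqrt (γ / 2))|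
                ≤ ε * Real.sqrt γ} (fun T => |Dmax n T - A|) (fun T => abs_nonneg _)
      (ε * √γ * n) ht ?_
  · refine ⟨le_trans ?_ hb.1, hb.2⟩
    have : uE m (eSet n) (fun T => |Dmax n T - A|) ≤ 2 * √(γ * n) + (γ + 1) := by
      refine hdev.trans ?_
      rw [hNp]
      have a1 : √((n - 1) * γ) ≤ √(γ * n) := Real.sqrt_le_sqrt (by nlinarith)
      have a2 : |((n : ℝ) - 1) * γ - m| ≤ γ + 1 := by
        rw [abs_le]; constructor <;> nlinarith
      linarith
    gcongr
  · intro G hG hGB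
    by_contra hlt
    push Not at hlt
    apply hGB
    show |(MaxCut G : ℝ) / n - (γ / 2 + Pstar * Real.sqrt (γ / 2))| ≤ ε * Real.sqrt γ
    rw [MaxCut_eq, hG]
    set D := Dmax n (gEdges G)
    have : ((m : ℝ) + D) / 2 / n - (γ / 2 + Pstar * √(γ / 2))
        = ((m - γ * n) + (D - A) + (A - r * M) + (r * M - 2 * √(γ / 2) * Pstar * n)) / (2 * n) := by
      field_simp; ring
    rw [this, abs_div, abs_of_pos (show (0 : ℝ) < 2 * n by positivity), div_le_iff₀ (by positivity)]
    rw [abs_lt] at hlt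
    rw [abs_le] at hmc h2' ⊢
    constructor <;> linarith [h2'.1, h2'.2, hlt.1, hlt.2, hmc.1, hmc.2]

/-- **Max-Cut of sparse Erdős–Rényi graphs.** -/
theorem maxcut_ER
    (Pstar : ℝ)
    (hP : Tendsto (fun n : ℕ =>
        (n : ℝ)⁻¹ * ∫ J, (⨆ σ : Fin n → Bool, -HSK n J σ) ∂(skMeasure n))
      atTop (nhds Pstar)) :
    ∀ ε > (0 : ℝ), ∃ γ₀ : ℝ, ∀ γ ≥ γ₀,
      Tendsto (fun n : ℕ =>
          probUniform {G : SimpleGraph (Fin n) | G.edgeSet.ncard = ⌊γ * n⌋₊}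
            {G : SimpleGraph (Fin n) |
              |(MaxCut G : ℝ) / n - (γ / 2 + Pstar * Real.sqrt (γ / 2))|
                ≤ ε * Real.sqrt γ})
        atTop (nhds 1) := by
  intro ε hε
  obtain ⟨L, hL⟩ : ∃ L : ℝ, L = Real.log 2 * 4 / ε := ⟨_, rfl⟩
  have hL0 : 0 < L := by
    have : 0 < Real.log 2 := Real.log_pos (by norm_num)
    rw [hL]; positivity
  refine ⟨max 1 ((8 * L ^ 2 * (1 + K3) / ε) ^ 2), fun γ hγ => ?_⟩
  have hγ1 : 1 ≤ γ := (le_max_left _ _).trans hγ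
  have hL2 : 8 * L ^ 2 * (1 + K3) / ε ≤ √γ :=
    Real.le_sqrt_of_sq_le ((le_max_right _ _).trans hγ)
  have hs : 0 < √γ := Real.sqrt_pos.2 (by linarith)
  have hninf : Tendsto (fun n : ℕ => (n : ℝ)) atTop atTop := tendsto_natCast_atTop_atTop
  have t1 : ∀ᶠ n : ℕ in atTop, (1 + γ) / n ≤ ε * √γ / 4 := by
    have : Tendsto (fun n : ℕ => (1 + γ) / (n : ℝ)) atTop (nhds 0) :=
      hninf.const_div_atTop _
    exact (this.eventually_lt_const (by positivity)).mono fun n h => h.le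
  have t2 : ∀ᶠ n : ℕ in atTop, |√(2 * γ * (1 - 2 * γ / n)) * ((n : ℝ)⁻¹ *
      ∫ J, (⨆ σ : Fin n → Bool, -HSK n J σ) ∂(skMeasure n)) - √(2 * γ) * Pstar|
        ≤ ε * √γ / 4 := by
    have a : Tendsto (fun n : ℕ => 2 * γ * (1 - 2 * γ / (n : ℝ))) atTop (nhds (2 * γ)) := by
      have := ((hninf.const_div_atTop (2 * γ)).const_sub 1).const_mul (2 * γ)
      simpa using this
    have b := ((a.sqrt.mul hP).sub_const (√(2 * γ) * Pstar)).abs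
    rw [sub_self, abs_zero] at b
    exact (b.eventually_lt_const (by positivity)).mono fun n h => h.le
  have t3 : ∀ᶠ n : ℕ in atTop, 2 * γ + 1 ≤ (n : ℝ) := hninf.eventually_ge_atTop _
  have lim : Tendsto (fun n : ℕ => 1 - (2 * √(γ * n) + (γ + 1)) / (ε * √γ * n))
      atTop (nhds 1) := by
    have q : Tendsto (fun n : ℕ => 2 / ε / √(n : ℝ) + (γ + 1) / (ε * √γ) / (n : ℝ))
        atTop (nhds (0 + 0)) :=
      ((Real.tendsto_sqrt_atTop.comp hninf).const_div_atTop _).add (hninf.const_div_atTop _)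
    have q2 := q.const_sub 1
    rw [add_zero, sub_zero] at q2
    refine q2.congr' ?_
    filter_upwards [t3] with n hn
    have hnpos : (0 : ℝ) < n := by linarith
    have hsn : 0 < √(n : ℝ) := Real.sqrt_pos.2 hnpos
    have hnn : √(n : ℝ) * √(n : ℝ) = n := Real.mul_self_sqrt hnpos.le
    rw [Real.sqrt_mul (by linarith), add_div (2 * (√γ * √(n : ℝ)))]
    congr 2
    · rw [div_div, div_eq_div_iff (by positivity) (by positivity)]
      linear_combination (-2 * ε * √γ) * hnn
    · rw [div_div]
  refine tendsto_of_tendsto_of_tendsto_of_le_of_le' lim tendsto_const_nhds ?_ ?_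
  · filter_upwards [t1, t2, t3] with n h1 h2 h3
    exact (final_bound hε hγ1 hL0 hL hL2 h3 Pstar _ rfl h1 h2).1
  · filter_upwards [t1, t2, t3] with n h1 h2 h3
    exact (final_bound hε hγ1 hL0 hL hL2 h3 Pstar _ rfl h1 h2).2
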